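/- arXiv:1511.06177 — 4 statements merged into one kernel-verified Lean document; each statement's English description precedes it below -/
import Mathlib

section
/- Let n be a positive integer and write 8n+13 = 3^β · n₁ with n₁ a positive integer not divisible by 3. Then t(1,3,3,6;n) = (2/5)·N(1,3,3,6; 8n+13) = (2/3)·(3^β + (n₁/3)) · Π_{p | n₁} (p^{ord_p(n₁)+1} − (6/p)^{ord_p(n₁)+1}) / (p − (6/p)), where the product is over the distinct prime divisors p of n₁, (·/p) and (n₁/3) are Legendre symbols, and ord_p(n₁) is the exact power of p dividing n₁. -/
/-- `N a b c d n` : number of integer quadruples `(x,y,z,w)` with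
`n = a*x^2 + b*y^2 + c*z^2 + d*w^2`. -/
noncomputable def N (a b c d : ℕ) (n : ℕ) : ℕ :=
  Set.ncard {P : ℤ × ℤ × ℤ × ℤ |
    (n : ℤ) = a * P.1 ^ 2 + b * P.2.1 ^ 2 + c * P.2.2.1 ^ 2 + d * P.2.2.2 ^ 2}

/-- `t a b c d n` : number of integer quadruples `(x,y,z,w)` with
`n = a*x(x-1)/2 + b*y(y-1)/2 + c*z(z-1)/2 + d*w(w-1)/2`. -/
noncomputable def t (a b c d : ℕ) (n : ℕ) : ℕ :=
  Set.ncard {P : ℤ × ℤ × ℤ × ℤ |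
    (n : ℤ) = a * (P.1 * (P.1 - 1) / 2) + b * (P.2.1 * (P.2.1 - 1) / 2)
      + c * (P.2.2.1 * (P.2.2.1 - 1) / 2) + d * (P.2.2.2 * (P.2.2.2 - 1) / 2)}

open Finset

/-- table -/
def Ftab : List ℤ :=
  [0, 1, -1, -4, 0, 0, 4, 0, 0, 0, 2, 0, 0, 0, 0, 1, 4, 0, 0, 0, -2, -1, 0, -4, 0, 0, 0,
   0, 0, -4, 0, -4, -4, 0, 0, 0, 6, 0, 0, 2, 0, 1, 0, 2, 0, 1, 0, -4, 0, 0, 0, 0, -2, 0,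
   0, 4, 0, 0, 0, 0, 0, 4, 4, -1, 4, 0, 0, 0, 2, 0, 0, 0, -6, 0, 0, 0, 0, -2, -2, -1, 0]

def F (a b x y : ZMod 3) : ℤ :=
  Ftab.getD (27 * a.val + 9 * b.val + 3 * x.val + y.val) 0

def chi (a : ZMod 3) : ℤ := if a = 1 then 1 else if a = 2 then -1 else 0

def Fp (a b x y : ZMod 3) : ℤ := F (-a) (b - a) (-x - y) y
def Fq (a b x y : ZMod 3) : ℤ := F a (a + b) (x - y) y
def Fr (a b x y : ZMod 3) : ℤ := F (b - x) b (-a) (y + a) - F (b + x) b a (y - a)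
def Gg (a b x y : ZMod 3) : ℤ :=
  F a b x y - F (-a) b (-x) y + 12 * (if b = 0 then chi a else 0)

def w3o (a b x y : ZMod 3) : ℤ := Fp a b x y - Fq a b x y + Fr a b x y
def w3e (a b x y : ZMod 3) : ℤ := w3o a b x y - Gg a b x y
def w2 (a b x y : ZMod 3) : ℤ := -Fp a b x y + Fq a b x y + Fr a b x y - Gg a b x y
def w1 (a b x y : ZMod 3) : ℤ := Fp a b x y + Fq a b x y

set_option maxRecDepth 100000 in
theorem F_neg : ∀ a b x y : ZMod 3, F (-a) (-b) (-x) (-y) = - F a b x y := by decide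
set_option maxRecDepth 100000 in
theorem w3e_sym : ∀ a b x y : ZMod 3, w3e a b x y + w3e x b a y - w3e a y x b - w3e x y a b = 0 := by
  decide
set_option maxRecDepth 100000 in
theorem w3o_sym : ∀ a b x y : ZMod 3,
    w3o a b x y + w3o (-x) b (-a) y - w3o a y x b - w3o (-x) y (-a) b = 0 := by
  decide
set_option maxRecDepth 100000 in
theorem w2_sym : ∀ a b x y : ZMod 3, w2 a b x y + w2 x b a y + w2 a y x b + w2 x y a b = 0 := by
  decide
set_option maxRecDepth 100000 in
theorem w1_symA : ∀ a b x y : ZMod 3,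
    w1 a b x y + w1 (-x) b (-a) y - w1 a y x b - w1 (-x) y (-a) b = 0 ∧
    Fr a b x y + Fr (-x) b (-a) y + Fr a y x b + Fr (-x) y (-a) b = 0 := by
  decide
set_option maxRecDepth 100000 in
theorem w1_symB : ∀ a b x y : ZMod 3,
    w1 a b x y - w1 (-x) b (-a) y + w1 a y x b - w1 (-x) y (-a) b = 0 ∧
    Fr a b x y + Fr (-x) b (-a) y - Fr a y x b - Fr (-x) y (-a) b = 0 := by
  decide


abbrev Z4 := ℤ × ℤ × ℤ × ℤ

noncomputable def Q (m : ℤ) : Finset Z4 :=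
  ((Icc 1 m) ×ˢ (Icc 1 m) ×ˢ (Icc 1 m) ×ˢ (Icc 1 m)).filter
    (fun v => v.1 * v.2.2.1 + v.2.1 * v.2.2.2 = m)

theorem mem_Q {m a b x y : ℤ} : (a, b, x, y) ∈ Q m ↔
    0 < a ∧ 0 < b ∧ 0 < x ∧ 0 < y ∧ a * x + b * y = m := by
  simp only [Q, mem_filter, mem_product, mem_Icc]
  constructor
  · rintro ⟨⟨⟨h1, _⟩, ⟨h2, _⟩, ⟨h3, _⟩, ⟨h4, _⟩⟩, h5⟩
    exact ⟨by omega, by omega, by omega, by omega, h5⟩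
  · rintro ⟨h1, h2, h3, h4, h5⟩
    have := mul_pos h1 h3
    have := mul_pos h2 h4
    refine ⟨⟨⟨by omega, ?_⟩, ⟨by omega, ?_⟩, ⟨by omega, ?_⟩, ⟨by omega, ?_⟩⟩, h5⟩ <;> nlinarith

/-- bijection helper -/
theorem sumQ_bij {m : ℤ} (p q : Z4 → Prop) [DecidablePred p] [DecidablePred q]
    (f g : Z4 → ℤ) (i j : Z4 → Z4)
    (hi : ∀ a b x y, 0 < a → 0 < b → 0 < x → 0 < y → a * x + b * y = m → p (a, b, x, y) →
      i (a, b, x, y) ∈ Q m ∧ q (i (a, b, x, y)) ∧ j (i (a, b, x, y)) = (a, b, x, y) ∧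
      f (a, b, x, y) = g (i (a, b, x, y)))
    (hj : ∀ a b x y, 0 < a → 0 < b → 0 < x → 0 < y → a * x + b * y = m → q (a, b, x, y) →
      j (a, b, x, y) ∈ Q m ∧ p (j (a, b, x, y)) ∧ i (j (a, b, x, y)) = (a, b, x, y)) :
    ∑ v ∈ (Q m).filter p, f v = ∑ v ∈ (Q m).filter q, g v := by
  refine Finset.sum_nbij' i j ?_ ?_ ?_ ?_ ?_
  · rintro ⟨a, b, x, y⟩ h
    rw [mem_filter, mem_Q] at h
    obtain ⟨⟨h1, h2, h3, h4, h5⟩, h6⟩ := h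
    have := hi a b x y h1 h2 h3 h4 h5 h6
    exact mem_filter.2 ⟨this.1, this.2.1⟩
  · rintro ⟨a, b, x, y⟩ h
    rw [mem_filter, mem_Q] at h
    obtain ⟨⟨h1, h2, h3, h4, h5⟩, h6⟩ := h
    have := hj a b x y h1 h2 h3 h4 h5 h6
    exact mem_filter.2 ⟨this.1, this.2.1⟩
  · rintro ⟨a, b, x, y⟩ h
    rw [mem_filter, mem_Q] at h
    obtain ⟨⟨h1, h2, h3, h4, h5⟩, h6⟩ := h
    exact (hi a b x y h1 h2 h3 h4 h5 h6).2.2.1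
  · rintro ⟨a, b, x, y⟩ h
    rw [mem_filter, mem_Q] at h
    obtain ⟨⟨h1, h2, h3, h4, h5⟩, h6⟩ := h
    exact (hj a b x y h1 h2 h3 h4 h5 h6).2.2
  · rintro ⟨a, b, x, y⟩ h
    rw [mem_filter, mem_Q] at h
    obtain ⟨⟨h1, h2, h3, h4, h5⟩, h6⟩ := h
    exact (hi a b x y h1 h2 h3 h4 h5 h6).2.2.2

theorem sumQ_swap (m : ℤ) (f : Z4 → ℤ) :
    ∑ v ∈ Q m, f v = ∑ v ∈ Q m, f (v.2.1, v.1, v.2.2.2, v.2.2.1) := by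
  have := sumQ_bij (m := m) (fun _ => True) (fun _ => True) f
    (fun v => f (v.2.1, v.1, v.2.2.2, v.2.2.1)) (fun v => (v.2.1, v.1, v.2.2.2, v.2.2.1))
    (fun v => (v.2.1, v.1, v.2.2.2, v.2.2.1))
    (fun a b x y h1 h2 h3 h4 h5 _ => ⟨mem_Q.2 ⟨h2, h1, h4, h3, by linarith⟩, trivial, rfl, rfl⟩)
    (fun a b x y h1 h2 h3 h4 h5 _ => ⟨mem_Q.2 ⟨h2, h1, h4, h3, by linarith⟩, trivial, rfl⟩)
  simpa using this

theorem sumQ_sw1 (m : ℤ) (f : Z4 → ℤ) :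
    ∑ v ∈ Q m, f v = ∑ v ∈ Q m, f (v.2.2.1, v.2.1, v.1, v.2.2.2) := by
  have := sumQ_bij (m := m) (fun _ => True) (fun _ => True) f
    (fun v => f (v.2.2.1, v.2.1, v.1, v.2.2.2)) (fun v => (v.2.2.1, v.2.1, v.1, v.2.2.2))
    (fun v => (v.2.2.1, v.2.1, v.1, v.2.2.2))
    (fun a b x y h1 h2 h3 h4 h5 _ => ⟨mem_Q.2 ⟨h3, h2, h1, h4, by linarith⟩, trivial, rfl, rfl⟩)
    (fun a b x y h1 h2 h3 h4 h5 _ => ⟨mem_Q.2 ⟨h3, h2, h1, h4, by linarith⟩, trivial, rfl⟩)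
  simpa using this

theorem lemmaA (m : ℤ) (f : ℤ → ℤ → ℤ → ℤ → ℤ)
    (hf : ∀ a b x y, f (a + b) b x (y - x) = f a (a + b) (x - y) y) :
    ∑ v ∈ Q m, f v.1 v.2.1 v.2.2.1 v.2.2.2
      - ∑ v ∈ (Q m).filter (fun v => v.1 = v.2.1), f v.1 v.2.1 v.2.2.1 v.2.2.2 =
    ∑ v ∈ Q m, f (v.1 + v.2.1) v.2.1 v.2.2.1 (v.2.2.2 - v.2.2.1)
      - ∑ v ∈ (Q m).filter (fun v => v.2.2.1 = v.2.2.2),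
          f (v.1 + v.2.1) v.2.1 v.2.2.1 (v.2.2.2 - v.2.2.1) := by
  have e1 := sumQ_bij (m := m) (fun v => v.2.1 < v.1) (fun v => v.2.2.1 < v.2.2.2)
    (fun v => f v.1 v.2.1 v.2.2.1 v.2.2.2)
    (fun v => f (v.1 + v.2.1) v.2.1 v.2.2.1 (v.2.2.2 - v.2.2.1))
    (fun v => (v.1 - v.2.1, v.2.1, v.2.2.1, v.2.2.1 + v.2.2.2))
    (fun v => (v.1 + v.2.1, v.2.1, v.2.2.1, v.2.2.2 - v.2.2.1))
    (fun a b x y h1 h2 h3 h4 h5 h6 => by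
      simp only at h6 ⊢
      refine ⟨mem_Q.2 ⟨by omega, h2, h3, by omega, by linarith⟩, by omega, by simp, ?_⟩
      congr 1 <;> ring)
    (fun a b x y h1 h2 h3 h4 h5 h6 => by
      simp only at h6 ⊢
      exact ⟨mem_Q.2 ⟨by omega, h2, h3, by omega, by linarith⟩, by omega, by simp⟩)
  have e2 := sumQ_bij (m := m) (fun v => v.1 < v.2.1) (fun v => v.2.2.2 < v.2.2.1)
    (fun v => f v.1 v.2.1 v.2.2.1 v.2.2.2)
    (fun v => f (v.1 + v.2.1) v.2.1 v.2.2.1 (v.2.2.2 - v.2.2.1))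
    (fun v => (v.1, v.2.1 - v.1, v.2.2.1 + v.2.2.2, v.2.2.2))
    (fun v => (v.1, v.2.1 + v.1, v.2.2.1 - v.2.2.2, v.2.2.2))
    (fun a b x y h1 h2 h3 h4 h5 h6 => by
      simp only at h6 ⊢
      refine ⟨mem_Q.2 ⟨h1, by omega, by omega, h4, by linarith⟩, by omega, by simp, ?_⟩
      rw [hf]
      congr 1 <;> ring)
    (fun a b x y h1 h2 h3 h4 h5 h6 => by
      simp only at h6 ⊢
      exact ⟨mem_Q.2 ⟨h1, by omega, by omega, h4, by linarith⟩, by omega, by simp⟩)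
  have s1 : ∀ (g : Z4 → ℤ) (u w : Z4 → ℤ), ∑ v ∈ Q m, g v =
      ∑ v ∈ (Q m).filter (fun v => u v < w v), g v + ∑ v ∈ (Q m).filter (fun v => w v < u v), g v
       + ∑ v ∈ (Q m).filter (fun v => u v = w v), g v := by
    intro g u w
    simp only [sum_filter, ← sum_add_distrib]
    refine sum_congr rfl fun v _ => ?_
    rcases lt_trichotomy (u v) (w v) with h | h | h
    · simp [h, h.ne, h.not_gt]
    · simp [h]
    · simp [h, h.ne', h.not_gt]
  rw [s1 _ (fun v => v.1) (fun v => v.2.1),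
    s1 (fun v => f (v.1 + v.2.1) v.2.1 v.2.2.1 (v.2.2.2 - v.2.2.1)) (fun v => v.2.2.1) (fun v => v.2.2.2)]

  linarith


def psi (b : ℤ) : ℤ := ZMod.χ₈' (b : ZMod 8)
def Fz (a b x y : ℤ) : ℤ := F (a : ZMod 3) (b : ZMod 3) (x : ZMod 3) (y : ZMod 3)
def phi (a b x y : ℤ) : ℤ := if 2 ∣ a ∧ 2 ∣ x then psi b * Fz a b x y else 0

theorem psi_neg (b : ℤ) : psi (-b) = - psi b := by
  unfold psi
  push_cast
  generalize (b : ZMod 8) = c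
  revert c; decide

theorem psi_mul (a b : ℤ) : psi (a * b) = psi a * psi b := by
  unfold psi
  rw [Int.cast_mul, map_mul]

theorem Fz_neg (a b x y : ℤ) : Fz (-a) (-b) (-x) (-y) = - Fz a b x y := by
  unfold Fz; push_cast; exact F_neg _ _ _ _

theorem phi_neg (a b x y : ℤ) : phi (-a) (-b) (-x) (-y) = phi a b x y := by
  unfold phi
  simp only [dvd_neg, psi_neg, Fz_neg, neg_mul_neg]

def fphi (a b x y : ℤ) : ℤ :=
  phi a b x y + phi (a - b) a (-y) (x + y) + phi (-b) (a - b) (-x - y) x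

theorem fphi_prop (a b x y : ℤ) : fphi (a + b) b x (y - x) = fphi a (a + b) (x - y) y := by
  have h := phi_neg (a + b) b x (y - x)
  unfold fphi
  have e1 : a + b - b = a := by ring
  have e2 : x + (y - x) = y := by ring
  have e3 : a - (a + b) = -b := by ring
  have e4 : -(y - x) = x - y := by ring
  have e5 : x - y + y = x := by ring
  have e6 : -x - (y - x) = -y := by ring
  have e7 : -(x - y) - y = -x := by ring
  rw [e1, e2, e3, e4, e5, e6, e7, ← h, e4]
  ring

def HH (a b x y : ℤ) : ℤ :=
  psi (b - a) * Fp a b x y - psi (a + b) * Fq a b x y + psi b * Fr a b x y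

theorem D1_eq (m : ℤ) (hm : ¬ 2 ∣ m) :
    ∑ v ∈ (Q m).filter (fun v => v.1 = v.2.1), fphi v.1 v.2.1 v.2.2.1 v.2.2.2 =
    ∑ v ∈ (Q m).filter (fun v => v.1 = v.2.1),
      if 2 ∣ v.2.2.2 then psi v.1 * Fz 0 v.1 (- v.2.2.2) (v.2.2.1 + v.2.2.2) else 0 := by
  refine sum_congr rfl ?_
  rintro ⟨a, b, x, y⟩ h
  rw [mem_filter, mem_Q] at h
  obtain ⟨⟨h1, h2, h3, h4, h5⟩, h6⟩ := h
  simp only at h6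
  subst h6
  have ha : ¬ 2 ∣ a := fun h => hm (by rw [← h5, ← mul_add]; exact Dvd.dvd.mul_right h _)
  simp [fphi, phi, ha]

theorem D2_eq (m : ℤ) (hm : ¬ 2 ∣ m) :
    ∑ v ∈ (Q m).filter (fun v => v.2.2.1 = v.2.2.2),
      fphi (v.1 + v.2.1) v.2.1 v.2.2.1 (v.2.2.2 - v.2.2.1) =
    ∑ v ∈ (Q m).filter (fun v => v.2.2.1 = v.2.2.2),
      if 2 ∣ v.1 then psi (v.1 + v.2.1) * Fz v.1 (v.1 + v.2.1) 0 v.2.2.1 else 0 := by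
  refine sum_congr rfl ?_
  rintro ⟨a, b, x, y⟩ h
  rw [mem_filter, mem_Q] at h
  obtain ⟨⟨h1, h2, h3, h4, h5⟩, h6⟩ := h
  simp only at h6
  subst h6
  have ha : ¬ 2 ∣ x := fun h => hm (by rw [← h5, ← add_mul]; exact Dvd.dvd.mul_left h _)
  simp [fphi, phi, ha]

theorem C1 (m : ℤ) (hm : ¬ 2 ∣ m) :
    ∑ v ∈ (Q m).filter (fun v => 2 ∣ v.1 ∧ 2 ∣ v.2.2.1),
      psi v.2.1 * (Fz v.1 v.2.1 v.2.2.1 v.2.2.2 - Fz (-v.1) v.2.1 (-v.2.2.1) v.2.2.2) +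
    ∑ v ∈ (Q m).filter (fun v => 2 ∣ v.1 ∧ ¬ 2 ∣ v.2.2.1), HH v.1 v.2.1 v.2.2.1 v.2.2.2 =
    ∑ v ∈ (Q m).filter (fun v => v.1 = v.2.1),
      (if 2 ∣ v.2.2.2 then psi v.1 * Fz 0 v.1 (- v.2.2.2) (v.2.2.1 + v.2.2.2) else 0) -
    ∑ v ∈ (Q m).filter (fun v => v.2.2.1 = v.2.2.2),
      (if 2 ∣ v.1 then psi (v.1 + v.2.1) * Fz v.1 (v.1 + v.2.1) 0 v.2.2.1 else 0) := by
  have hA := lemmaA m fphi fphi_prop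
  rw [D1_eq m hm, D2_eq m hm] at hA
  have t1 := sumQ_swap m (fun v => phi (-v.2.1) v.1 (-v.2.2.2) v.2.2.1)
  have t2 := sumQ_swap m (fun v => phi (-v.2.1) (v.1 - v.2.1) (-v.2.2.1 - v.2.2.2) v.2.2.1)
  have t3 := sumQ_sw1 m (fun v => phi (v.1 + v.2.1) v.2.1 v.2.2.1 (v.2.2.2 - v.2.2.1))
  have t4 := sumQ_swap m (fun v => phi (v.1 - v.2.1) v.1 (-v.2.2.2) (v.2.2.1 + v.2.2.2))
  have t5 := sumQ_sw1 m (fun v => phi (v.2.1 - v.1) v.2.1 (-v.2.2.1) (v.2.2.2 + v.2.2.1))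
  have e : ∑ v ∈ Q m, fphi v.1 v.2.1 v.2.2.1 v.2.2.2 -
      ∑ v ∈ Q m, fphi (v.1 + v.2.1) v.2.1 v.2.2.1 (v.2.2.2 - v.2.2.1) =
    ∑ v ∈ (Q m).filter (fun v => 2 ∣ v.1 ∧ 2 ∣ v.2.2.1),
      psi v.2.1 * (Fz v.1 v.2.1 v.2.2.1 v.2.2.2 - Fz (-v.1) v.2.1 (-v.2.2.1) v.2.2.2) +
    ∑ v ∈ (Q m).filter (fun v => 2 ∣ v.1 ∧ ¬ 2 ∣ v.2.2.1), HH v.1 v.2.1 v.2.2.1 v.2.2.2 := by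
    have l1 : ∑ v ∈ Q m, fphi v.1 v.2.1 v.2.2.1 v.2.2.2 =
      ∑ v ∈ Q m, (phi v.1 v.2.1 v.2.2.1 v.2.2.2 + phi (v.2.1 - v.2.2.1) v.2.1 (-v.1) (v.2.2.2 + v.1)
        + phi (-v.1) (v.2.1 - v.1) (-v.2.2.2 - v.2.2.1) v.2.2.2) := by
      simp only [fphi, sum_add_distrib]
      simp only at t2 t4 t5
      rw [t2, t4, ← t5]
    have l2 : ∑ v ∈ Q m, fphi (v.1 + v.2.1) v.2.1 v.2.2.1 (v.2.2.2 - v.2.2.1) =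
      ∑ v ∈ Q m, (phi (v.2.2.1 + v.2.1) v.2.1 v.1 (v.2.2.2 - v.1)
        + phi v.1 (v.1 + v.2.1) (v.2.2.1 - v.2.2.2) v.2.2.2 + phi (-v.1) v.2.1 (-v.2.2.1) v.2.2.2) := by
      simp only [fphi, sum_add_distrib]
      simp only at t1 t3
      rw [t3, ← t1]
      congr 2
      · refine sum_congr rfl fun v _ => ?_
        congr 1 <;> ring
      · funext v
        congr 1 <;> ring
    rw [l1, l2, ← sum_sub_distrib, sum_filter, sum_filter, ← sum_add_distrib]
    refine sum_congr rfl ?_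
    rintro ⟨a, b, x, y⟩ h
    rw [mem_Q] at h
    obtain ⟨h1, h2, h3, h4, h5⟩ := h
    simp only
    have key : 2 ∣ a → ¬ 2 ∣ b ∧ ¬ 2 ∣ y := by
      intro h
      have : 2 ∣ a * x := Dvd.dvd.mul_right h _
      constructor
      · intro h'
        have : 2 ∣ b * y := Dvd.dvd.mul_right h' _
        omega
      · intro h'
        have : 2 ∣ b * y := Dvd.dvd.mul_left h' _
        omega
    by_cases ha : 2 ∣ a
    · obtain ⟨hb, hy⟩ := key ha
      by_cases hx : 2 ∣ x
      · have c1 : ¬ 2 ∣ b - x := by omega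
        have c2 : ¬ 2 ∣ -y - x := by omega
        have c3 : ¬ 2 ∣ x + b := by omega
        have c4 : ¬ 2 ∣ x - y := by omega
        simp [phi, ha, hx, c1, c2, c3, c4]
        ring
      · have c1 : 2 ∣ b - x := by omega
        have c2 : 2 ∣ -y - x := by omega
        have c3 : 2 ∣ x + b := by omega
        have c4 : 2 ∣ x - y := by omega
        simp only [phi, ha, hx, c1, c2, c3, c4, HH, Fz, Fp, Fq, Fr, dvd_neg]
        simp
        have d1 : (-(y : ZMod 3) - x) = -x - y := by ring
        have d2 : ((x : ZMod 3) + b) = b + x := by ring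
        rw [d1, d2]
        ring
    · simp [phi, ha]
  linarith


noncomputable def v2 (a : ℤ) : ℕ := padicValInt 2 a

theorem v2_eq (k : ℕ) (o : ℤ) (ho : ¬ 2 ∣ o) : v2 (2 ^ k * o) = k := by
  have ho0 : o ≠ 0 := by rintro rfl; simp at ho
  unfold v2
  have : Fact (Nat.Prime 2) := ⟨Nat.prime_two⟩
  rw [padicValInt.mul (by positivity) ho0]
  have h1 : padicValInt 2 o = 0 := padicValInt.eq_zero_of_not_dvd (by simpa using ho)
  have h2 : padicValInt 2 ((2 : ℤ) ^ k) = k := by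
    have := padicValNat.prime_pow (p := 2) k
    unfold padicValInt
    rw [Int.natAbs_pow]; exact this
  omega

theorem v2_spec (a : ℤ) (ha : a ≠ 0) : ∃ (k : ℕ) (o : ℤ), ¬ 2 ∣ o ∧ a = 2 ^ k * o := by
  have h : FiniteMultiplicity (2 : ℤ) a := Int.finiteMultiplicity_iff.2 ⟨by decide, ha⟩
  obtain ⟨c, hc, hc'⟩ := h.exists_eq_pow_mul_and_not_dvd
  exact ⟨_, c, hc', hc⟩

theorem v2_two (a : ℤ) (ha : a ≠ 0) : v2 (2 * a) = v2 a + 1 := by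
  obtain ⟨k, o, ho, rfl⟩ := v2_spec a ha
  rw [v2_eq k o ho, ← mul_assoc, ← pow_succ', v2_eq _ o ho]

theorem v2_even_four (a : ℤ) (ha : a ≠ 0) (h : 2 ∣ a) (h2 : Even (v2 a)) : 4 ∣ a := by
  obtain ⟨k, o, ho, rfl⟩ := v2_spec a ha
  rw [v2_eq k o ho] at h2
  obtain ⟨j, rfl⟩ := h2
  rcases j with _ | j
  · simp at h; exact absurd h ho
  · exact ⟨2 ^ (j + j) * o, by ring⟩

theorem scale1 (m : ℤ) (G : ℤ → ℤ → ℤ → ℤ → ℤ)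
    (hG : ∀ a b x y, G (2 * a) b x y = - G a b (2 * x) y) :
    ∑ v ∈ (Q m).filter (fun v => 2 ∣ v.1 ∧ 2 ∣ v.2.2.1), G v.1 v.2.1 v.2.2.1 v.2.2.2 =
    - ∑ v ∈ (Q m).filter (fun v => 4 ∣ v.1), G v.1 v.2.1 v.2.2.1 v.2.2.2 := by
  rw [← sum_neg_distrib]
  refine sumQ_bij _ _ _ _ (fun v => (2 * v.1, v.2.1, v.2.2.1 / 2, v.2.2.2))
    (fun v => (v.1 / 2, v.2.1, 2 * v.2.2.1, v.2.2.2)) ?_ ?_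
  · rintro a b x y h1 h2 h3 h4 h5 ⟨h6, h7⟩
    obtain ⟨x, rfl⟩ := h7
    simp only at h6 ⊢
    have e : 2 * x / 2 = x := by omega
    rw [e, hG]
    refine ⟨mem_Q.2 ⟨by omega, h2, by omega, h4, by linarith⟩, by omega, ?_, by ring⟩
    simp
  · rintro a b x y h1 h2 h3 h4 h5 h6
    obtain ⟨a, rfl⟩ := h6
    simp only
    have e : 4 * a / 2 = 2 * a := by omega
    rw [e]
    refine ⟨mem_Q.2 ⟨by omega, h2, by omega, h4, by linarith⟩, by omega, ?_⟩
    simp; ring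

theorem scale2 (m : ℤ) (G : ℤ → ℤ → ℤ → ℤ → ℤ)
    (hG : ∀ a b x y, G (2 * a) b x y = - G a b (2 * x) y) :
    ∑ v ∈ (Q m).filter (fun v => 4 ∣ v.1), G v.1 v.2.1 v.2.2.1 v.2.2.2 =
    ∑ v ∈ (Q m).filter (fun v => 2 ∣ v.1 ∧ ¬ 2 ∣ v.2.2.1),
      if Even (v2 v.1) then G v.1 v.2.1 v.2.2.1 v.2.2.2 else 0 := by
  have e1 : ∑ v ∈ (Q m).filter (fun v => 4 ∣ v.1 ∧ ¬ Even (v2 v.1)), G v.1 v.2.1 v.2.2.1 v.2.2.2 =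
     ∑ v ∈ (Q m).filter (fun v => (4 ∣ v.1 ∧ Even (v2 v.1)) ∧ 2 ∣ v.2.2.1),
       - G v.1 v.2.1 v.2.2.1 v.2.2.2 := by
    refine sumQ_bij _ _ _ _ (fun v => (v.1 / 2, v.2.1, 2 * v.2.2.1, v.2.2.2))
      (fun v => (2 * v.1, v.2.1, v.2.2.1 / 2, v.2.2.2)) ?_ ?_
    · rintro a b x y h1 h2 h3 h4 h5 ⟨h6, h7⟩
      obtain ⟨a, rfl⟩ := h6
      simp only at h7 ⊢
      have e : 4 * a / 2 = 2 * a := by omega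
      have e' : 4 * a = 2 * (2 * a) := by ring
      rw [e]
      rw [e', v2_two _ (by omega), Nat.even_add_one, not_not] at h7
      have h8 := v2_even_four _ (by omega) ⟨a, rfl⟩ h7
      refine ⟨mem_Q.2 ⟨by omega, h2, by omega, h4, by linarith⟩, ⟨⟨h8, h7⟩, by simp⟩, ?_, ?_⟩
      · simp; ring
      · rw [e', hG]
    · rintro a b x y h1 h2 h3 h4 h5 ⟨⟨h6, h7⟩, h8⟩
      obtain ⟨x, rfl⟩ := h8
      simp only at h6 h7 ⊢
      have e : 2 * x / 2 = x := by omega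
      rw [e]
      refine ⟨mem_Q.2 ⟨by omega, h2, by omega, h4, by linarith⟩, ⟨by omega, ?_⟩, by simp⟩
      rw [v2_two _ (by omega), Nat.even_add_one, not_not]; exact h7
  rw [sum_neg_distrib] at e1
  rw [← sum_filter_add_sum_filter_not ((Q m).filter (fun v => 4 ∣ v.1)) (fun v => Even (v2 v.1)),
    filter_filter, filter_filter, e1,
    ← sum_filter_add_sum_filter_not ((Q m).filter (fun v => 4 ∣ v.1 ∧ Even (v2 v.1)))
      (fun v => 2 ∣ v.2.2.1), filter_filter, filter_filter, ← sum_filter, filter_filter]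
  rw [add_comm (∑ v ∈ _, _), add_assoc, add_neg_cancel, add_zero]
  refine sum_congr ?_ fun _ _ => rfl
  ext ⟨a, b, x, y⟩
  simp only [mem_filter, mem_Q]
  constructor
  · rintro ⟨h, ⟨h1, h2⟩, h3⟩
    exact ⟨h, ⟨by omega, h3⟩, h2⟩
  · rintro ⟨h, ⟨h1, h2⟩, h3⟩
    exact ⟨h, ⟨v2_even_four _ (by omega) h1 h3, h3⟩, h2⟩

def GG (a b x y : ℤ) : ℤ := psi b * Gg a b x y

set_option maxRecDepth 100000 in
theorem Gg_anti : ∀ a b x y : ZMod 3, Gg (2 * a) b x y = - Gg a b (2 * x) y := by decide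

theorem GG_anti (a b x y : ℤ) : GG (2 * a) b x y = - GG a b (2 * x) y := by
  unfold GG
  push_cast
  rw [Gg_anti]; ring

noncomputable def WW (a b x y : ℤ) : ℤ := HH a b x y - if Even (v2 a) then GG a b x y else 0

def p8 (b : ZMod 8) : ℤ := ZMod.χ₈' b

theorem psi_p8 (b : ℤ) : psi b = p8 b := rfl

theorem odd_sq8 (o : ℤ) (ho : ¬ 2 ∣ o) : (o : ZMod 8) * o = 1 := by
  have h : (8 : ℤ) ∣ o * o - 1 := by
    have : o % 8 = 1 ∨ o % 8 = 3 ∨ o % 8 = 5 ∨ o % 8 = 7 := by omega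
    apply Int.dvd_of_emod_eq_zero
    rcases this with h | h | h | h <;> simp [Int.sub_emod, Int.mul_emod, h]
  have := (ZMod.intCast_zmod_eq_zero_iff_dvd (o * o - 1) 8).2 (by exact_mod_cast h)
  push_cast at this
  linear_combination this

theorem sg3 : ∀ b : ZMod 8, p8 (5 * b) = - p8 b := by decide
theorem sg2 : ∀ b o : ZMod 8, o * o = 1 → p8 (b - 4 * o) = - p8 b ∧ p8 (4 * o + b) = - p8 b := by decide
theorem sg1a : ∀ b o : ZMod 8, o * o = 1 → b * b = 1 → p8 (b - 2 * o) = - p8 (2 * o + b) := by decide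
theorem sg1b : ∀ b o : ZMod 8, o * o = 1 → b * b = 1 → 
   p8 (2 * o + 3 * b) = - p8 (2 * o + b) ∧ p8 (2 * o + (- b)) = p8 (2 * o + b) ∧ p8 (3 * b) = p8 b ∧
   p8 (-b) = - p8 b := by decide
theorem sg1c : ∀ o x : ZMod 8, o * o = 1 → x * x = 1 → (2 * x = 2 * o ∧ 2 * o * x = 2) ∨
   (2 * x = - (2 * o) ∧ 2 * o * x = 6) := by decide

theorem Wk (k : ℕ) (o b x y : ℤ) (hk : k ≠ 0) (ho : ¬ 2 ∣ o) (hx : ¬ 2 ∣ x) (hb : ¬ 2 ∣ b)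
    (hy : ¬ 2 ∣ y) (h5 : (2 : ZMod 8) ^ k * o * x + b * y = 5) :
    WW (2 ^ k * o) b x y + WW (2 ^ k * x) b o y + WW (2 ^ k * o) y x b + WW (2 ^ k * x) y o b = 0 := by
  have ho8 := odd_sq8 o ho
  have hx8 := odd_sq8 x hx
  have hb8 := odd_sq8 b hb
  have hy8 := odd_sq8 y hy
  simp only [WW, HH, GG, v2_eq k o ho, v2_eq k x hx, psi_p8]
  push_cast
  have hyb : (y : ZMod 8) = b * (5 - 2 ^ k * o * x) := by linear_combination b * h5 - y * hb8
  generalize (o : ZMod 8) = o8 at *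
  generalize (x : ZMod 8) = x8 at *
  generalize (b : ZMod 8) = b8 at *
  generalize (y : ZMod 8) = y8 at *
  have h2 : (2 : ZMod 3) = -1 := by decide
  rw [h2]
  obtain rfl | rfl | hk3 : k = 1 ∨ k = 2 ∨ 3 ≤ k := by omega
  · have hne : ¬ Even 1 := by decide
    simp only [hne, if_false, pow_one, sub_zero]
    rw [sg1a b8 o8 ho8 hb8, sg1a b8 x8 hx8 hb8, sg1a y8 o8 ho8 hy8, sg1a y8 x8 hx8 hy8]
    obtain ⟨s1, s2, s3, s4⟩ := sg1b b8 o8 ho8 hb8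
    rcases sg1c o8 x8 ho8 hx8 with ⟨c1, c2⟩ | ⟨c1, c2⟩
    · have hy' : y8 = 3 * b8 := by rw [hyb, pow_one, c2]; ring
      rw [hy', c1, s1, s3]
      obtain ⟨q1, q2⟩ := w1_symA (-1 * (o : ZMod 3)) b x y
      simp only [neg_mul, one_mul, neg_neg, w1] at q1 q2 ⊢
      linear_combination (-p8 (2 * o8 + b8)) * q1 + p8 b8 * q2
    · have c6 : (5 - 6 : ZMod 8) = -1 := by decide
      have hy' : y8 = - b8 := by rw [hyb, pow_one, c2, c6]; ring
      have s5 : p8 (-(2 * o8) + b8) = - p8 (2 * o8 + b8) := by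
        rw [← sg1a b8 o8 ho8 hb8]; ring_nf
      have s6 : p8 (-(2 * o8) + -b8) = - p8 (2 * o8 + b8) := by
        have : ∀ z : ZMod 8, p8 (-z) = - p8 z := by decide
        rw [← this]; ring_nf
      rw [hy', c1, s2, s4, s5, s6]
      obtain ⟨q1, q2⟩ := w1_symB (-1 * (o : ZMod 3)) b x y
      simp only [neg_mul, one_mul, neg_neg, w1] at q1 q2 ⊢
      linear_combination (-p8 (2 * o8 + b8)) * q1 + p8 b8 * q2
  · have hne : Even 2 := by decide
    have h4 : (2 : ZMod 8) ^ 2 = 4 := by decide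
    have h1 : (-1 : ZMod 3) ^ 2 = 1 := by decide
    simp only [hne, if_true, h4, h1, one_mul] at hyb ⊢
    have hy' : y8 = b8 := by
      have : ∀ o x b : ZMod 8, o * o = 1 → x * x = 1 → b * (5 - 4 * o * x) = b := by decide
      rw [hyb]; exact this _ _ _ ho8 hx8
    rw [hy', (sg2 b8 o8 ho8).1, (sg2 b8 o8 ho8).2, (sg2 b8 x8 hx8).1, (sg2 b8 x8 hx8).2]
    have q := w2_sym o b x y
    simp only [w2] at q
    linear_combination p8 b8 * q
  · have h0 : (2 : ZMod 8) ^ k = 0 := by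
      obtain ⟨j, rfl⟩ := Nat.exists_eq_add_of_le hk3
      rw [pow_add]
      have : (2 : ZMod 8) ^ 3 = 0 := by decide
      rw [this, zero_mul]
    simp only [h0, zero_mul, sub_zero, zero_add] at hyb ⊢
    rw [hyb, mul_comm b8, sg3]
    rcases Nat.even_or_odd k with hke | hko
    · have h1 : (-1 : ZMod 3) ^ k = 1 := hke.neg_one_pow
      simp only [hke, if_true, h1, one_mul]
      have q := w3e_sym o b x y
      simp only [w3e, w3o] at q
      linear_combination p8 b8 * q
    · have h1 : (-1 : ZMod 3) ^ k = -1 := hko.neg_one_pow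
      simp only [Nat.not_even_iff_odd.2 hko, if_false, h1]
      have q := w3o_sym (-1 * (o : ZMod 3)) b x y
      simp only [w3o, neg_mul, one_mul, neg_neg] at q ⊢
      linear_combination p8 b8 * q

theorem sumW (m : ℤ) (hm : m % 8 = 5) :
    ∑ v ∈ (Q m).filter (fun v => 2 ∣ v.1 ∧ ¬ 2 ∣ v.2.2.1), WW v.1 v.2.1 v.2.2.1 v.2.2.2 = 0 := by
  have s2 : ∀ g : Z4 → ℤ, ∑ v ∈ (Q m).filter (fun v => 2 ∣ v.1 ∧ ¬ 2 ∣ v.2.2.1), g v =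
      ∑ v ∈ (Q m).filter (fun v => 2 ∣ v.1 ∧ ¬ 2 ∣ v.2.2.1), g (v.1, v.2.2.2, v.2.2.1, v.2.1) := by
    intro g
    refine sumQ_bij _ _ _ _ (fun v => (v.1, v.2.2.2, v.2.2.1, v.2.1))
      (fun v => (v.1, v.2.2.2, v.2.2.1, v.2.1)) ?_ ?_
    · intro a b x y h1 h2 h3 h4 h5 h6
      exact ⟨mem_Q.2 ⟨h1, h4, h3, h2, by linarith⟩, h6, rfl, rfl⟩
    · intro a b x y h1 h2 h3 h4 h5 h6
      exact ⟨mem_Q.2 ⟨h1, h4, h3, h2, by linarith⟩, h6, rfl⟩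
  have s1 : ∀ g : Z4 → ℤ, ∑ v ∈ (Q m).filter (fun v => 2 ∣ v.1 ∧ ¬ 2 ∣ v.2.2.1), g v =
      ∑ v ∈ (Q m).filter (fun v => 2 ∣ v.1 ∧ ¬ 2 ∣ v.2.2.1),
        g (2 ^ (v2 v.1) * v.2.2.1, v.2.1, v.1 / 2 ^ (v2 v.1), v.2.2.2) := by
    intro g
    have key : ∀ a b x y, 0 < a → 0 < b → 0 < x → 0 < y → a * x + b * y = m → (2 ∣ a ∧ ¬ 2 ∣ x) →
       ((2 ^ (v2 a) * x, b, a / 2 ^ (v2 a), y) ∈ Q m) ∧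
       (2 ∣ 2 ^ (v2 a) * x ∧ ¬ 2 ∣ a / 2 ^ (v2 a)) ∧ 
       2 ^ (v2 (2 ^ (v2 a) * x)) * (a / 2 ^ (v2 a)) = a ∧
       (2 ^ (v2 a) * x) / 2 ^ (v2 (2 ^ (v2 a) * x)) = x := by
      rintro a b x y h1 h2 h3 h4 h5 ⟨h6, h7⟩
      obtain ⟨k, o, ho, rfl⟩ := v2_spec a (by omega)
      have hp : (0 : ℤ) < 2 ^ k := by positivity
      rw [v2_eq _ _ ho, v2_eq _ _ h7, Int.mul_ediv_cancel_left _ hp.ne',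
        Int.mul_ediv_cancel_left _ hp.ne']
      have ho' : 0 < o := pos_of_mul_pos_right h1 hp.le
      refine ⟨mem_Q.2 ⟨by positivity, h2, ho', h4, by linarith⟩, ⟨?_, ho⟩, rfl, rfl⟩
      rcases k with _ | k
      · simp at h6; exact absurd h6 ho
      · rw [pow_succ']; exact ⟨2 ^ k * x, by ring⟩
    symm
    refine sumQ_bij _ _ _ _ (fun v => (2 ^ (v2 v.1) * v.2.2.1, v.2.1, v.1 / 2 ^ (v2 v.1), v.2.2.2))
      (fun v => (2 ^ (v2 v.1) * v.2.2.1, v.2.1, v.1 / 2 ^ (v2 v.1), v.2.2.2)) ?_ ?_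
    · intro a b x y h1 h2 h3 h4 h5 h6
      obtain ⟨k1, k2, k3, k4⟩ := key a b x y h1 h2 h3 h4 h5 h6
      refine ⟨k1, k2, ?_, rfl⟩
      simp only [k3, k4]
    · intro a b x y h1 h2 h3 h4 h5 h6
      obtain ⟨k1, k2, k3, k4⟩ := key a b x y h1 h2 h3 h4 h5 h6
      refine ⟨k1, k2, ?_⟩
      simp only [k3, k4]
  have e1 := s1 (fun v => WW v.1 v.2.1 v.2.2.1 v.2.2.2)
  have e2 := s2 (fun v => WW v.1 v.2.1 v.2.2.1 v.2.2.2)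
  have e3 := s1 (fun v => WW v.1 v.2.2.2 v.2.2.1 v.2.1)
  simp only at e1 e2 e3
  have tot : ∑ v ∈ (Q m).filter (fun v => 2 ∣ v.1 ∧ ¬ 2 ∣ v.2.2.1),
     (WW v.1 v.2.1 v.2.2.1 v.2.2.2 + WW (2 ^ (v2 v.1) * v.2.2.1) v.2.1 (v.1 / 2 ^ (v2 v.1)) v.2.2.2
     + WW v.1 v.2.2.2 v.2.2.1 v.2.1 +
     WW (2 ^ (v2 v.1) * v.2.2.1) v.2.2.2 (v.1 / 2 ^ (v2 v.1)) v.2.1) = 0 := by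
    refine sum_eq_zero ?_
    rintro ⟨a, b, x, y⟩ h
    rw [mem_filter, mem_Q] at h
    obtain ⟨⟨h1, h2, h3, h4, h5⟩, h6, h7⟩ := h
    simp only at h6 h7 ⊢
    have h0 : 2 ∣ a * x := Dvd.dvd.mul_right h6 _
    have hb : ¬ 2 ∣ b := by
      intro h'
      have : 2 ∣ b * y := Dvd.dvd.mul_right h' _
      omega
    have hy : ¬ 2 ∣ y := by
      intro h'
      have : 2 ∣ b * y := Dvd.dvd.mul_left h' _
      omega
    obtain ⟨k, o, ho, rfl⟩ := v2_spec a (by omega)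
    have hp : (0 : ℤ) < 2 ^ k := by positivity
    rw [v2_eq _ _ ho, Int.mul_ediv_cancel_left _ hp.ne']
    refine Wk k o b x y ?_ ho h7 hb hy ?_
    · rintro rfl
      simp at h6; exact ho h6
    · have : ((m - 5 : ℤ) : ZMod 8) = 0 :=
        (ZMod.intCast_zmod_eq_zero_iff_dvd _ 8).2 (by push_cast; omega)
      rw [← h5] at this
      push_cast at this
      linear_combination this
  simp only [sum_add_distrib] at tot
  linarith

theorem E2 (m : ℤ) (hm : m % 8 = 5) :
    ∑ v ∈ (Q m).filter (fun v => 4 ∣ v.1), 12 * (if 3 ∣ v.2.1 then chi v.1 * psi v.2.1 else 0) =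
    ∑ v ∈ (Q m).filter (fun v => v.1 = v.2.1),
      (if 2 ∣ v.2.2.2 then psi v.1 * Fz 0 v.1 (- v.2.2.2) (v.2.2.1 + v.2.2.2) else 0) -
    ∑ v ∈ (Q m).filter (fun v => v.2.2.1 = v.2.2.2),
      (if 2 ∣ v.1 then psi (v.1 + v.2.1) * Fz v.1 (v.1 + v.2.1) 0 v.2.2.1 else 0) := by
  have h1 := C1 m (by omega)
  have h2 := sumW m hm
  have h3 := scale2 m GG GG_anti
  have hanti : ∀ a b x y : ℤ, psi b * (Fz (2 * a) b x y - Fz (-(2 * a)) b (-x) y) =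
     - (psi b * (Fz a b (2 * x) y - Fz (-a) b (-(2 * x)) y)) := by
    intro a b x y
    unfold Fz
    push_cast
    have h2 : (2 : ZMod 3) = -1 := by decide
    rw [h2]
    simp only [neg_mul, one_mul, neg_neg]
    ring
  have h4 := scale1 m (fun a b x y => psi b * (Fz a b x y - Fz (-a) b (-x) y)) hanti
  simp only [WW, sum_sub_distrib] at h2
  rw [h4] at h1
  rw [← h1]
  have h5 : ∑ v ∈ (Q m).filter (fun v => 4 ∣ v.1), GG v.1 v.2.1 v.2.2.1 v.2.2.2 =
    ∑ v ∈ (Q m).filter (fun v => 4 ∣ v.1),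
      psi v.2.1 * (Fz v.1 v.2.1 v.2.2.1 v.2.2.2 - Fz (-v.1) v.2.1 (-v.2.2.1) v.2.2.2) +
    ∑ v ∈ (Q m).filter (fun v => 4 ∣ v.1), 12 * (if 3 ∣ v.2.1 then chi v.1 * psi v.2.1 else 0) := by
    rw [← sum_add_distrib]
    refine sum_congr rfl fun v _ => ?_
    have : ((v.2.1 : ZMod 3) = 0) ↔ 3 ∣ v.2.1 := by
      rw [ZMod.intCast_zmod_eq_zero_iff_dvd]; norm_num
    simp only [GG, Gg, Fz, this]
    push_cast
    split_ifs <;> ring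
  linarith


theorem D1_sum (m : ℕ) (hm : m ≠ 0) :
    ∑ v ∈ (Q m).filter (fun v => v.1 = v.2.1),
      (if 2 ∣ v.2.2.2 then psi v.1 * Fz 0 v.1 (- v.2.2.2) (v.2.2.1 + v.2.2.2) else 0) =
    ∑ d ∈ m.divisorsAntidiagonal, ∑ j ∈ range ((d.1 - 1) / 2),
      psi d.2 * F 0 (d.2 : ZMod 3) ((j : ZMod 3) + 1) (d.1 : ZMod 3) := by
  rw [← sum_filter, sum_sigma']
  symm
  refine sum_bij' (fun p _ => ((p.1.2 : ℤ), (p.1.2 : ℤ), (p.1.1 : ℤ) - 2 * (p.2 + 1), 2 * ((p.2 : ℤ) + 1)))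
    (fun v _ => ⟨((v.2.2.1 + v.2.2.2).toNat, v.1.toNat), (v.2.2.2 / 2).toNat - 1⟩) ?_ ?_ ?_ ?_ ?_
  · rintro ⟨⟨c, x⟩, j⟩ h
    simp only [mem_sigma, Nat.mem_divisorsAntidiagonal, mem_range] at h
    obtain ⟨⟨h1, _⟩, h2⟩ := h
    simp only [mem_filter, mem_Q]
    have hx : 0 < x := Nat.pos_of_ne_zero (by rintro rfl; simp at h1; omega)
    refine ⟨⟨⟨by omega, by omega, by omega, by omega, ?_⟩, trivial⟩, by simp⟩
    rw [← h1]; push_cast; ring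
  · rintro ⟨a, b, x, y⟩ h
    simp only [mem_filter, mem_Q] at h
    obtain ⟨⟨⟨h1, h2, h3, h4, h5⟩, rfl⟩, h6⟩ := h
    simp only [mem_sigma, Nat.mem_divisorsAntidiagonal, mem_range]
    refine ⟨⟨?_, hm⟩, by omega⟩
    zify
    rw [Int.toNat_of_nonneg (by omega), Int.toNat_of_nonneg (by omega), ← h5]
    ring
  · rintro ⟨⟨c, x⟩, j⟩ h
    simp
  · rintro ⟨a, b, x, y⟩ h
    simp only [mem_filter, mem_Q] at h
    obtain ⟨⟨⟨h1, h2, h3, h4, h5⟩, rfl⟩, h6⟩ := h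
    simp only [Prod.mk.injEq]
    omega
  · rintro ⟨⟨c, x⟩, j⟩ h
    simp only [Fz]
    push_cast
    have h2 : (2 : ZMod 3) = -1 := by decide
    rw [h2]
    congr 2 <;> ring

theorem D2_sum (m : ℕ) (hm : m ≠ 0) :
    ∑ v ∈ (Q m).filter (fun v => v.2.2.1 = v.2.2.2),
      (if 2 ∣ v.1 then psi (v.1 + v.2.1) * Fz v.1 (v.1 + v.2.1) 0 v.2.2.1 else 0) =
    ∑ d ∈ m.divisorsAntidiagonal, ∑ j ∈ range ((d.1 - 1) / 2),
      psi d.1 * F (-((j : ZMod 3) + 1)) (d.1 : ZMod 3) 0 (d.2 : ZMod 3) := by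
  rw [← sum_filter, sum_sigma']
  symm
  refine sum_bij' (fun p _ => (2 * ((p.2 : ℤ) + 1), (p.1.1 : ℤ) - 2 * (p.2 + 1), (p.1.2 : ℤ), (p.1.2 : ℤ)))
    (fun v _ => ⟨((v.1 + v.2.1).toNat, v.2.2.1.toNat), (v.1 / 2).toNat - 1⟩) ?_ ?_ ?_ ?_ ?_
  · rintro ⟨⟨c, x⟩, j⟩ h
    simp only [mem_sigma, Nat.mem_divisorsAntidiagonal, mem_range] at h
    obtain ⟨⟨h1, _⟩, h2⟩ := h
    simp only [mem_filter, mem_Q]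
    have hx : 0 < x := Nat.pos_of_ne_zero (by rintro rfl; simp at h1; omega)
    refine ⟨⟨⟨by omega, by omega, by omega, by omega, ?_⟩, trivial⟩, by simp⟩
    rw [← h1]; push_cast; ring
  · rintro ⟨a, b, x, y⟩ h
    simp only [mem_filter, mem_Q] at h
    obtain ⟨⟨⟨h1, h2, h3, h4, h5⟩, rfl⟩, h6⟩ := h
    simp only [mem_sigma, Nat.mem_divisorsAntidiagonal, mem_range]
    refine ⟨⟨?_, hm⟩, by omega⟩
    zify
    rw [Int.toNat_of_nonneg (by omega), Int.toNat_of_nonneg (by omega), ← h5]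
    ring
  · rintro ⟨⟨c, x⟩, j⟩ h
    simp
  · rintro ⟨a, b, x, y⟩ h
    simp only [mem_filter, mem_Q] at h
    obtain ⟨⟨⟨h1, h2, h3, h4, h5⟩, rfl⟩, h6⟩ := h
    simp only [Prod.mk.injEq]
    omega
  · rintro ⟨⟨c, x⟩, j⟩ h
    simp only [Fz]
    push_cast
    have h2 : (2 : ZMod 3) = -1 := by decide
    rw [h2]
    have e : (-1 * ((j : ZMod 3) + 1) + (c - -1 * (j + 1))) = c := by ring
    have e' : (2 * ((j : ℤ) + 1) + (c - 2 * (j + 1))) = c := by ring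
    rw [e, e', neg_one_mul]

theorem per_sum (g : ZMod 3 → ℤ) (q s : ℕ) : ∑ j ∈ range (3 * q + s), g ((j : ZMod 3) + 1) =
    q * (g 0 + g 1 + g 2) + ∑ j ∈ range s, g ((j : ZMod 3) + 1) := by
  induction q with
  | zero => simp
  | succ q ih =>
    have h3 : (3 : ZMod 3) = 0 := by decide
    have e : 3 * (q + 1) + s = 3 * q + s + 1 + 1 + 1 := by ring
    rw [e, sum_range_succ, sum_range_succ, sum_range_succ, ih]
    push_cast
    rw [h3]
    simp only [zero_mul, zero_add]
    have : ∀ z : ZMod 3, g (z + 1) + g (z + 1 + 1) + g (z + 2 + 1) = g 0 + g 1 + g 2 := by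
      intro z
      have hz : z = 0 ∨ z = 1 ∨ z = 2 := by revert z; decide
      have f0 : (0 + 1 : ZMod 3) = 1 := by decide
      have f1 : (0 + 2 : ZMod 3) = 2 := by decide
      have f2 : (1 + 1 : ZMod 3) = 2 := by decide
      have f3 : (2 + 1 : ZMod 3) = 0 := by decide
      have f4 : (1 + 2 : ZMod 3) = 0 := by decide
      have f5 : (2 + 2 : ZMod 3) = 1 := by decide
      rcases hz with rfl | rfl | rfl
      · rw [f0, f1, f2, f3]; ring
      · rw [f2, f4, f3, f0]; ring
      · rw [f3, f0, f5, f2]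
    linear_combination this (s : ZMod 3)

def kap (c x : ZMod 3) : ℤ :=
  if c = 0 then (if x = 1 then 1 else if x = 2 then 2 else -4)
  else if x = 0 then (if c = 1 then -1 else 0)
  else if c = x then -(chi x + chi c) else 0

theorem tab_S : ∀ c x : ZMod 3, (F 0 x 0 c + F (-0) c 0 x) + (F 0 x 1 c + F (-1) c 0 x) +
   (F 0 x 2 c + F (-2) c 0 x) = 6 * (chi x + chi c) := by decide

theorem tab_0 : ∀ x : ZMod 3, 0 = 1 * (chi x + chi 1) + kap 1 x := by decide
theorem tab_1 : ∀ x : ZMod 3, F 0 x 1 0 + F (-1) 0 0 x = 3 * (chi x + chi 0) + kap 0 x := by decide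
theorem tab_2 : ∀ x : ZMod 3, F 0 x 1 2 + F (-1) 2 0 x + (F 0 x 2 2 + F (-2) 2 0 x)
   = 5 * (chi x + chi 2) + kap 2 x := by decide

theorem kinner_sum (c : ℕ) (hc : c % 2 = 1) (x : ZMod 3) :
    ∑ j ∈ range ((c - 1) / 2), (F 0 x ((j : ZMod 3) + 1) (c : ZMod 3) +
      F (-((j : ZMod 3) + 1)) (c : ZMod 3) 0 x) = c * (chi x + chi c) + kap c x := by
  have hS := tab_S c x
  have h6 : (6 : ZMod 3) = 0 := by decide
  obtain ⟨q, s, hs, e1⟩ : ∃ q s, s < 3 ∧ c = 6 * q + (2 * s + 1) :=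
    ⟨c / 6, (c % 6) / 2, by omega, by omega⟩
  have e2 : (c - 1) / 2 = 3 * q + s := by omega
  rw [e2, per_sum (fun z => F 0 x z c + F (-z) c 0 x)]
  simp only [hS]
  have e3 : (c : ZMod 3) = 2 * s + 1 := by rw [e1]; push_cast; rw [h6]; ring
  rw [e3]
  have e4 : (c : ℤ) = 6 * q + (2 * s + 1) := by exact_mod_cast e1
  rw [e4]
  have f2 : (1 + 1 : ZMod 3) = 2 := by decide
  have f3 : (2 + 1 : ZMod 3) = 0 := by decide
  have f4 : (2 * 2 + 1 : ZMod 3) = 2 := by decide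
  interval_cases s
  · have := tab_0 x
    simp
    linear_combination this
  · have := tab_1 x
    simp [f3]
    linear_combination this
  · have := tab_2 x
    simp [sum_range_succ, f2, f4]
    have f5 : (-1 + -1 : ZMod 3) = -2 := by decide
    rw [f5]
    linear_combination this

theorem psi_anti (m c x : ℕ) (hm : m % 8 = 5) (h : c * x = m) : psi c = - psi x := by
  have h1 : (c : ZMod 8) * x = 5 := by
    rw [← Nat.cast_mul, h]
    have : ((m : ℕ) : ZMod 8) = ((5 : ℕ) : ZMod 8) := (ZMod.natCast_eq_natCast_iff _ _ _).2 hm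
    exact this
  have : ∀ u v : ZMod 8, u * v = 5 → p8 u = - p8 v := by decide
  simp only [psi_p8, Int.cast_natCast]
  exact this _ _ h1

theorem Dtot (m : ℕ) (hm : m % 8 = 5) :
    ∑ v ∈ (Q m).filter (fun v => 4 ∣ v.1), 12 * (if 3 ∣ v.2.1 then chi v.1 * psi v.2.1 else 0) =
    ∑ d ∈ m.divisorsAntidiagonal, d.1 * psi d.2 * (chi d.2 + chi d.1) +
    ∑ d ∈ m.divisorsAntidiagonal, psi d.2 * kap d.1 d.2 := by
  rw [E2 m (by omega), D1_sum m (by omega), D2_sum m (by omega), ← sum_sub_distrib, ← sum_add_distrib]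
  refine sum_congr rfl ?_
  rintro ⟨c, x⟩ h
  rw [Nat.mem_divisorsAntidiagonal] at h
  simp only at h ⊢
  rw [← mul_sum, ← mul_sum, psi_anti m c x hm h.1]
  have hc : c % 2 = 1 := by
    by_contra hc
    have : 2 ∣ c := by omega
    have : 2 ∣ c * x := Dvd.dvd.mul_right this _
    omega
  have := kinner_sum c hc (x : ZMod 3)
  rw [sum_add_distrib] at this
  linear_combination psi x * this

theorem DA_swap (m : ℕ) (g : ℕ → ℕ → ℤ) :
    ∑ d ∈ m.divisorsAntidiagonal, g d.1 d.2 = ∑ d ∈ m.divisorsAntidiagonal, g d.2 d.1 := by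
  refine sum_bij' (fun d _ => (d.2, d.1)) (fun d _ => (d.2, d.1)) ?_ ?_ ?_ ?_ ?_ <;>
    simp +contextual [mul_comm]

theorem DA_three (β n₁ : ℕ) (h3 : ¬ 3 ∣ n₁) (g : ℕ → ℕ → ℤ) :
    ∑ d ∈ (3 ^ β * n₁).divisorsAntidiagonal, (if 3 ∣ d.2 then 0 else g d.1 d.2) =
    ∑ d ∈ n₁.divisorsAntidiagonal, g (3 ^ β * d.1) d.2 := by
  have hn : n₁ ≠ 0 := by rintro rfl; simp at h3
  have : ∀ d : ℕ × ℕ, (if 3 ∣ d.2 then 0 else g d.1 d.2) = if ¬ 3 ∣ d.2 then g d.1 d.2 else 0 := by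
    intro d; split_ifs <;> rfl
  simp only [this]
  rw [← sum_filter]
  symm
  have hp : 0 < 3 ^ β := by positivity
  have key : ∀ c x, c * x = 3 ^ β * n₁ → ¬ 3 ∣ x → 3 ^ β ∣ c := by
    intro c x h1 h2
    have : Nat.Coprime (3 ^ β) x := Nat.Coprime.pow_left _ ((Nat.Prime.coprime_iff_not_dvd Nat.prime_three).2 h2)
    exact this.dvd_of_dvd_mul_right ⟨n₁, h1⟩
  refine sum_bij' (fun d _ => (3 ^ β * d.1, d.2)) (fun d _ => (d.1 / 3 ^ β, d.2)) ?_ ?_ ?_ ?_ ?_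
  · rintro ⟨c, x⟩ h
    simp only [Nat.mem_divisorsAntidiagonal, mem_filter] at h ⊢
    refine ⟨⟨by rw [mul_assoc, h.1], by positivity⟩, fun h' => h3 ?_⟩
    rw [← h.1]; exact Dvd.dvd.mul_left h' _
  · rintro ⟨c, x⟩ h
    simp only [Nat.mem_divisorsAntidiagonal, mem_filter] at h ⊢
    obtain ⟨e, rfl⟩ := key c x h.1.1 h.2
    refine ⟨?_, hn⟩
    rw [Nat.mul_div_cancel_left _ hp]
    have := h.1.1
    rw [mul_assoc] at this
    exact Nat.eq_of_mul_eq_mul_left hp this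
  · rintro ⟨c, x⟩ h
    simp only [Nat.mul_div_cancel_left _ hp]
  · rintro ⟨c, x⟩ h
    simp only [Nat.mem_divisorsAntidiagonal, mem_filter] at h
    simp only [Nat.mul_div_cancel' (key c x h.1.1 h.2)]
  · intros; rfl

theorem kap_anti : ∀ c x : ZMod 3, kap c x - kap x c =
   2 * ((if c = 0 then (if x = 0 then 0 else 1) else 0) - (if x = 0 then (if c = 0 then 0 else 1) else 0)) := by
  decide

theorem cast3 (x : ℕ) : (x : ZMod 3) = 0 ↔ 3 ∣ x := ZMod.natCast_eq_zero_iff _ _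

theorem psi_three (β : ℕ) (x : ℕ) : psi ((3 ^ β * x : ℕ)) = psi x := by
  push_cast
  rw [psi_mul]
  have : psi (3 ^ β) = 1 := by
    induction β with
    | zero => rfl
    | succ k ih => rw [pow_succ, psi_mul, ih]; rfl
  rw [this, one_mul]

theorem kap_zero (m β n₁ : ℕ) (hm : m % 8 = 5) (h3 : ¬ 3 ∣ n₁) (h : m = 3 ^ β * n₁) :
    ∑ d ∈ m.divisorsAntidiagonal, psi d.2 * kap d.1 d.2 = 0 := by
  have anti : ∀ g : ℕ → ℕ → ℤ, ∑ d ∈ m.divisorsAntidiagonal, psi d.2 * g d.1 d.2 =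
      - ∑ d ∈ m.divisorsAntidiagonal, psi d.2 * g d.2 d.1 := by
    intro g
    rw [DA_swap m (fun c x => psi x * g c x), ← sum_neg_distrib]
    refine sum_congr rfl ?_
    rintro ⟨c, x⟩ h
    rw [Nat.mem_divisorsAntidiagonal] at h
    simp only at h ⊢
    rw [psi_anti m c x hm h.1]; ring
  have a1 := anti (fun c x => kap c x)
  have a2 := anti (fun c x => if (c : ZMod 3) = 0 then (if (x : ZMod 3) = 0 then 0 else 1) else 0)
  have e : ∑ d ∈ m.divisorsAntidiagonal, psi d.2 * kap d.1 d.2 -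
     ∑ d ∈ m.divisorsAntidiagonal, psi d.2 * kap d.2 d.1 =
     2 * (∑ d ∈ m.divisorsAntidiagonal, psi d.2 * (if (d.1 : ZMod 3) = 0 then (if (d.2 : ZMod 3) = 0 then 0 else 1) else 0) -
     ∑ d ∈ m.divisorsAntidiagonal, psi d.2 * (if (d.2 : ZMod 3) = 0 then (if (d.1 : ZMod 3) = 0 then 0 else 1) else 0)) := by
    rw [← sum_sub_distrib, ← sum_sub_distrib, mul_sum]
    refine sum_congr rfl fun d _ => ?_
    linear_combination psi d.2 * kap_anti d.1 d.2
  have z : ∑ d ∈ m.divisorsAntidiagonal, psi d.2 * (if (d.1 : ZMod 3) = 0 then (if (d.2 : ZMod 3) = 0 then 0 else 1) else 0) = 0 := by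
    have := DA_three β n₁ h3 (fun c x => psi x * if (c : ZMod 3) = 0 then 1 else 0)
    rw [← h] at this
    have e' : ∀ d : ℕ × ℕ, psi d.2 * (if (d.1 : ZMod 3) = 0 then (if (d.2 : ZMod 3) = 0 then 0 else 1) else 0) =
      (if 3 ∣ d.2 then 0 else psi d.2 * if (d.1 : ZMod 3) = 0 then 1 else 0) := by
      intro d
      simp only [cast3]
      split_ifs <;> simp
    simp only [e']
    rw [this]
    rcases β with _ | β
    · refine sum_eq_zero ?_
      rintro ⟨c, x⟩ h
      rw [Nat.mem_divisorsAntidiagonal] at h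
      simp only at h ⊢
      have : ¬ 3 ∣ c := fun h' => h3 (by rw [← h.1]; exact Dvd.dvd.mul_right h' _)
      rw [if_neg, mul_zero]
      rw [cast3]; simpa using this
    · have i : ∀ d : ℕ × ℕ, psi d.2 * (if ((3 ^ (β + 1) * d.1 : ℕ) : ZMod 3) = 0 then 1 else 0) = psi d.2 := by
        intro d
        rw [if_pos, mul_one]
        rw [cast3, pow_succ']; exact ⟨3 ^ β * d.1, by ring⟩
      simp only [i]
      have sw := DA_swap n₁ (fun c x => psi x)
      have neg : ∑ d ∈ n₁.divisorsAntidiagonal, psi d.1 = - ∑ d ∈ n₁.divisorsAntidiagonal, psi d.2 := by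
        rw [← sum_neg_distrib]
        refine sum_congr rfl ?_
        rintro ⟨c, x⟩ h'
        rw [Nat.mem_divisorsAntidiagonal] at h'
        simp only at h' ⊢
        have := psi_anti m (3 ^ (β + 1) * c) x hm (by rw [mul_assoc, h'.1, h])
        rwa [psi_three] at this
      linarith
  linarith

theorem Part3 (m β n₁ : ℕ) (hm : m % 8 = 5) (h3 : ¬ 3 ∣ n₁) (h : m = 3 ^ β * n₁) :
    12 * ∑ v ∈ (Q m).filter (fun v => 4 ∣ v.1), (if 3 ∣ v.2.1 then chi v.1 * psi v.2.1 else 0) =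
    ∑ d ∈ m.divisorsAntidiagonal, d.1 * psi d.2 * (chi d.2 + chi d.1) := by
  rw [mul_sum, Dtot m hm, kap_zero m β n₁ hm h3 h, add_zero]


theorem chi_mul (a b : ZMod 3) : chi (a * b) = chi a * chi b := by revert a b; decide

theorem jac3 (n : ℕ) : jacobiSym n 3 = chi n := by
  rw [jacobiSym.mod_left]
  have h : ((n : ℕ) : ZMod 3) = ((n % 3 : ℕ) : ZMod 3) := by simp
  rw [h]
  have : ((n : ℤ) % (3 : ℕ)) = ((n % 3 : ℕ) : ℤ) := by push_cast; rfl
  rw [this]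
  have : n % 3 < 3 := Nat.mod_lt _ (by norm_num)
  interval_cases (n % 3)
  · rw [show chi ((0 : ℕ) : ZMod 3) = 0 by decide]; norm_num
  · rw [show chi ((1 : ℕ) : ZMod 3) = 1 by decide]; norm_num
  · rw [show chi ((2 : ℕ) : ZMod 3) = -1 by decide]; norm_num

def c24 (x : ℕ) : ℤ := psi x * chi x

theorem c24_mul (x y : ℕ) : c24 (x * y) = c24 x * c24 y := by
  unfold c24
  push_cast
  rw [psi_mul, chi_mul]; ring

theorem jac6 (p : ℕ) (hp : p % 2 = 1) : jacobiSym 6 p = c24 p := by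
  have hodd : Odd p := Nat.odd_iff.2 hp
  have e : (6 : ℤ) = (-2) * (-3) := by norm_num
  rw [e, jacobiSym.mul_left, jacobiSym.at_neg_two hodd, c24]
  have e1 : ZMod.χ₈' (p : ZMod 8) = psi p := by simp [psi]
  rw [e1]
  congr 1
  rw [← jac3, jacobiSym.neg _ hodd]
  have h4 : p % 4 = 1 ∨ p % 4 = 3 := by omega
  rcases h4 with h4 | h4
  · rw [ZMod.χ₄_nat_one_mod_four h4, one_mul]
    exact jacobiSym.quadratic_reciprocity_one_mod_four' (by decide) h4
  · rw [ZMod.χ₄_nat_three_mod_four h4]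
    have := jacobiSym.quadratic_reciprocity_three_mod_four (a := 3) (b := p) (by norm_num) h4
    push_cast at this
    rw [this]; ring

theorem P4a (m β n₁ : ℕ) (h3 : ¬ 3 ∣ n₁) (h : m = 3 ^ β * n₁) :
    ∑ d ∈ m.divisorsAntidiagonal, (d.1 : ℤ) * psi d.2 * (chi d.2 + chi d.1) =
    (3 ^ β + chi n₁) * ∑ d ∈ n₁.divisorsAntidiagonal, (d.1 : ℤ) * c24 d.2 := by
  have cz : ∀ x : ℕ, 3 ∣ x → chi x = 0 := by
    intro x hx
    rw [(cast3 x).2 hx]; rfl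
  have a1 := DA_three β n₁ h3 (fun c x => (c : ℤ) * psi x * chi x)
  have a2 := DA_three β n₁ h3 (fun c x => (x : ℤ) * psi c * chi x)
  rw [← h] at a1 a2
  rw [DA_swap m (fun c x => if 3 ∣ x then 0 else (x : ℤ) * psi c * chi x),
    DA_swap n₁ (fun c x => (x : ℤ) * psi (3 ^ β * c : ℕ) * chi x)] at a2
  have e1 : ∀ d : ℕ × ℕ, (d.1 : ℤ) * psi d.2 * (chi d.2 + chi d.1) =
     (if 3 ∣ d.2 then 0 else (d.1 : ℤ) * psi d.2 * chi d.2) +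
     (if 3 ∣ d.1 then 0 else (d.1 : ℤ) * psi d.2 * chi d.1) := by
    intro d
    by_cases h1 : 3 ∣ d.1 <;> by_cases h2 : 3 ∣ d.2
    · simp [h1, h2, cz]
    · simp [h1, h2, cz]
    · simp [h1, h2, cz]
    · simp only [h1, h2, if_false]; ring
  simp only [e1, sum_add_distrib]
  rw [a1, a2, mul_sum, ← sum_add_distrib]
  refine sum_congr rfl ?_
  rintro ⟨c, x⟩ hd
  rw [Nat.mem_divisorsAntidiagonal] at hd
  obtain ⟨hd, hn⟩ := hd
  simp only at hd ⊢
  have hx : ¬ 3 ∣ x := fun h' => h3 (by rw [← hd]; exact Dvd.dvd.mul_left h' _)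
  have hx2 : chi x * chi x = 1 := by
    have : ∀ z : ZMod 3, z ≠ 0 → chi z * chi z = 1 := by decide
    exact this _ (by rwa [Ne, cast3])
  have e5 : chi ((c * x : ℕ) : ZMod 3) = chi c * chi x := by rw [Nat.cast_mul, chi_mul]
  rw [psi_three, ← hd, e5, c24]
  push_cast
  linear_combination (-(c * psi x * chi c)) * hx2

def c24A : ArithmeticFunction ℚ := ⟨fun x => (c24 x : ℚ), by
  have : c24 0 = 0 := by decide
  rw [this]; rfl⟩
def idA : ArithmeticFunction ℚ := ⟨fun x => (x : ℚ), by simp⟩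

theorem c24A_mult : c24A.IsMultiplicative := by
  refine ⟨by change ((c24 1 : ℤ) : ℚ) = 1; rw [show c24 1 = 1 by decide]; simp, ?_⟩
  intro m n _
  change ((c24 (m * n) : ℤ) : ℚ) = (c24 m : ℚ) * (c24 n : ℚ)
  rw [c24_mul]; push_cast; rfl

theorem idA_mult : idA.IsMultiplicative := by
  refine ⟨by change ((1 : ℕ) : ℚ) = 1; simp, ?_⟩
  intro m n _
  change ((m * n : ℕ) : ℚ) = (m : ℚ) * (n : ℚ)
  push_cast; rfl

theorem c24_pow (p k : ℕ) : c24 (p ^ k) = c24 p ^ k := by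
  induction k with
  | zero => rw [pow_zero, pow_zero]; rfl
  | succ k ih => rw [pow_succ, c24_mul, ih, pow_succ]

theorem P4b (n₁ : ℕ) (hn : n₁ ≠ 0) (hodd : n₁ % 2 = 1) :
    ((∑ d ∈ n₁.divisorsAntidiagonal, (d.1 : ℤ) * c24 d.2 : ℤ) : ℚ) =
    ∏ p ∈ n₁.primeFactors,
        ((p : ℚ) ^ (n₁.factorization p + 1) - (jacobiSym 6 p : ℚ) ^ (n₁.factorization p + 1)) /
          ((p : ℚ) - (jacobiSym 6 p : ℚ)) := by
  have h1 : ((∑ d ∈ n₁.divisorsAntidiagonal, (d.1 : ℤ) * c24 d.2 : ℤ) : ℚ) = (idA * c24A) n₁ := by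
    rw [ArithmeticFunction.mul_apply]
    push_cast
    rfl
  rw [h1, (idA_mult.mul c24A_mult).multiplicative_factorization _ hn, Finsupp.prod, Nat.support_factorization]
  refine prod_congr rfl ?_
  intro p hp
  have hpp := Nat.prime_of_mem_primeFactors hp
  have hpd := Nat.dvd_of_mem_primeFactors hp
  have hp2 : p % 2 = 1 := by
    by_contra h
    have : 2 ∣ n₁ := (show 2 ∣ p by omega).trans hpd
    omega
  rw [jac6 p hp2]
  generalize n₁.factorization p = k
  have hc : ((c24 p : ℤ) : ℚ) ≤ 1 := by
    have : c24 p ≤ 1 := by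
      have u : ∀ a : ZMod 8, p8 a ≤ 1 ∧ -1 ≤ p8 a := by decide
      have v : ∀ a : ZMod 3, chi a ≤ 1 ∧ -1 ≤ chi a := by decide
      unfold c24
      rw [psi_p8]
      obtain ⟨u1, u2⟩ := u ((p : ℤ) : ZMod 8)
      obtain ⟨v1, v2⟩ := v (p : ZMod 3)
      nlinarith
    exact_mod_cast this
  have hp1 : (2 : ℚ) ≤ p := by exact_mod_cast hpp.two_le
  rw [eq_div_iff (by linarith), ArithmeticFunction.mul_apply, ← geom_sum₂_mul]
  congr 1
  rw [Nat.sum_divisorsAntidiagonal (fun a b => idA a * c24A b), Nat.sum_divisors_prime_pow hpp]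
  refine sum_congr rfl ?_
  intro i hi
  rw [mem_range] at hi
  rw [Nat.pow_div (by omega) hpp.pos]
  change ((p ^ i : ℕ) : ℚ) * (c24 (p ^ (k - i)) : ℚ) = _
  rw [c24_pow]
  push_cast
  rfl


noncomputable def rset (D N : ℕ) : Finset (ℤ × ℤ) :=
  ((Icc (-(N : ℤ)) N) ×ˢ (Icc (-(N : ℤ)) N)).filter (fun v => v.1 ^ 2 + D * v.2 ^ 2 = N)

theorem sq_le_bd {x : ℤ} {N : ℕ} (h : x ^ 2 ≤ N) : -(N : ℤ) ≤ x ∧ x ≤ N := by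
  constructor <;> nlinarith [Int.le_self_sq x, Int.le_self_sq (-x)]

theorem mem_rset {D N : ℕ} (hD : 0 < D) {x y : ℤ} : (x, y) ∈ rset D N ↔ x ^ 2 + D * y ^ 2 = N := by
  simp only [rset, mem_filter, mem_product, mem_Icc]
  refine ⟨fun h => h.2, fun h => ⟨⟨?_, ?_⟩, h⟩⟩
  · apply sq_le_bd
    have : 0 ≤ (D : ℤ) * y ^ 2 := by positivity
    linarith
  · apply sq_le_bd
    have : (1 : ℤ) ≤ D := by exact_mod_cast hD
    nlinarith [sq_nonneg x, sq_nonneg y]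

noncomputable def rr (D N : ℕ) : ℤ := (rset D N).card

/-- Thue -/
theorem thue (p : ℕ) (hp : p.Prime) (s : ZMod p) : ∃ x y : ℤ, (x ≠ 0 ∨ y ≠ 0) ∧
    x ^ 2 < p ∧ y ^ 2 < p ∧ (x : ZMod p) = s * y := by
  have : NeZero p := ⟨hp.ne_zero⟩
  obtain ⟨k, hk⟩ : ∃ k, k = Nat.sqrt p := ⟨_, rfl⟩
  have h1 : p < (k + 1) * (k + 1) := by rw [hk]; exact Nat.lt_succ_sqrt p
  have h2 : k * k < p := by
    have h3 : k * k ≤ p := by rw [hk]; exact Nat.sqrt_le p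
    rcases h3.lt_or_eq with h | h
    · exact h
    · exfalso
      rcases (Nat.prime_mul_iff.1 (h ▸ hp : (k * k).Prime)) with h | h
      · rw [h.2] at h; exact Nat.not_prime_one h.1
      · rw [h.2] at h; exact Nat.not_prime_one h.1
  have hc : (univ : Finset (ZMod p)).card < (range (k + 1) ×ˢ range (k + 1)).card := by
    rw [card_product, card_range, card_univ, ZMod.card]; exact h1
  obtain ⟨⟨u, v⟩, hu, ⟨u', v'⟩, hu', hne, heq⟩ := exists_ne_map_eq_of_card_lt_of_maps_to hc
    (f := fun w => (w.1 : ZMod p) - s * w.2) (fun _ _ => by simp)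
  simp only [mem_product, mem_range] at hu hu' heq
  have bd : ∀ a b : ℕ, a < k + 1 → b < k + 1 → ((a : ℤ) - b) ^ 2 < p := by
    intro a b ha hb
    have h3 : (k : ℤ) * k < p := by exact_mod_cast h2
    have : |(a : ℤ) - b| ≤ k := by rw [abs_le]; constructor <;> omega
    have := sq_le_sq' (by linarith [abs_le.1 this]) (abs_le.1 this).2
    nlinarith
  refine ⟨(u : ℤ) - u', (v : ℤ) - v', ?_, bd _ _ hu.1 hu'.1, bd _ _ hu.2 hu'.2, ?_⟩
  · by_contra h
    push Not at h
    apply hne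
    ext
    · simp only; omega
    · simp only; omega
  · push_cast
    linear_combination heq

theorem rep_of_sq (D p : ℕ) (hp : p.Prime) (hp2 : p ≠ 2) (hD : D = 2 ∨ D = 3)
    (hs : IsSquare ((-D : ℤ) : ZMod p)) : ∃ a b : ℤ, a ^ 2 + D * b ^ 2 = p := by
  obtain ⟨s, hs⟩ := hs
  obtain ⟨x, y, h0, hx, hy, hxy⟩ := thue p hp s
  have hdvd : (p : ℤ) ∣ x ^ 2 + D * y ^ 2 := by
    rw [← ZMod.intCast_zmod_eq_zero_iff_dvd]
    push_cast at hs ⊢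
    rw [hxy]
    linear_combination (-(y : ZMod p) ^ 2) * hs
  obtain ⟨j, hj⟩ := hdvd
  have hp0 : (0 : ℤ) < p := by exact_mod_cast hp.pos
  have hpos : 0 < x ^ 2 + D * y ^ 2 := by
    rcases hD with rfl | rfl <;> rcases h0 with h | h <;> push_cast <;> positivity
  have hj0 : 0 < j := by
    by_contra h
    nlinarith
  have hpodd : (p : ℤ) % 2 = 1 := by
    have := hp.eq_two_or_odd
    omega
  rcases hD with rfl | rfl
  · push_cast at *
    have hj3 : j < 3 := by nlinarith
    interval_cases j
    · exact ⟨x, y, by linarith⟩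
    · have : 2 ∣ x ^ 2 := ⟨p - y ^ 2, by linarith⟩
      obtain ⟨z, rfl⟩ := Int.prime_two.dvd_of_dvd_pow this
      exact ⟨y, z, by linarith⟩
  · push_cast at *
    have hj3 : j < 4 := by nlinarith
    interval_cases j
    · exact ⟨x, y, by linarith⟩
    · exfalso
      have hx4 : x ^ 2 % 4 = 0 ∨ x ^ 2 % 4 = 1 := by
        rcases Int.even_or_odd' x with ⟨z, rfl | rfl⟩ <;> ring_nf <;> omega
      have hy4 : y ^ 2 % 4 = 0 ∨ y ^ 2 % 4 = 1 := by
        rcases Int.even_or_odd' y with ⟨z, rfl | rfl⟩ <;> ring_nf <;> omega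
      omega
    · have : 3 ∣ x ^ 2 := ⟨p - y ^ 2, by linarith⟩
      obtain ⟨z, rfl⟩ := Int.prime_three.dvd_of_dvd_pow this
      exact ⟨y, z, by linarith⟩

theorem rr_scale (D p M : ℕ) (hD : 0 < D) (hp : 0 < p) (S : Finset (ℤ × ℤ))
    (hS : ∀ x y : ℤ, (x, y) ∈ S ↔ ((p : ℤ) ∣ x ∧ (p : ℤ) ∣ y) ∧ x ^ 2 + D * y ^ 2 = p * (p * M : ℕ)) :
    (S.card : ℤ) = rr D M := by
  unfold rr
  norm_cast
  have hp' : (p : ℤ) ≠ 0 := by exact_mod_cast hp.ne'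
  symm
  refine card_bij' (fun v _ => (p * v.1, p * v.2)) (fun v _ => (v.1 / p, v.2 / p)) ?_ ?_ ?_ ?_
  · rintro ⟨x, y⟩ h
    rw [mem_rset hD] at h
    rw [hS]
    refine ⟨⟨by simp, by simp⟩, ?_⟩
    push_cast
    rw [← h]; ring
  · rintro ⟨x, y⟩ h
    rw [hS] at h
    obtain ⟨⟨⟨x, rfl⟩, ⟨y, rfl⟩⟩, h⟩ := h
    rw [mem_rset hD, Int.mul_ediv_cancel_left _ hp', Int.mul_ediv_cancel_left _ hp']
    push_cast at h
    have : (p : ℤ) * (p * (x ^ 2 + D * y ^ 2)) = p * (p * M) := by rw [← h]; ring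
    exact mul_left_cancel₀ hp' (mul_left_cancel₀ hp' this)
  · rintro ⟨x, y⟩ h
    simp [Int.mul_ediv_cancel_left _ hp']
  · rintro ⟨x, y⟩ h
    rw [hS] at h
    obtain ⟨⟨⟨x, rfl⟩, ⟨y, rfl⟩⟩, h⟩ := h
    simp [Int.mul_ediv_cancel_left _ hp']

theorem hecke_split (D p N : ℕ) (hD : 0 < D) (hp : p.Prime) (hp2 : p ≠ 2) (a b : ℤ)
    (hab : a ^ 2 + D * b ^ 2 = p) (ha : ¬ (p : ℤ) ∣ a) (hb : ¬ (p : ℤ) ∣ b) :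
    rr D (p * N) = 2 * rr D N - if p ∣ N then rr D (N / p) else 0 := by
  have hpZ : Prime (p : ℤ) := Nat.prime_iff_prime_int.1 hp
  have hp' : (p : ℤ) ≠ 0 := hpZ.ne_zero
  have hA : ∀ a b : ℤ, a ^ 2 + D * b ^ 2 = p →
      (((rset D (p * N)).filter (fun v => (p : ℤ) ∣ a * v.2 - b * v.1)).card : ℤ) = rr D N := by
    intro a b hab
    unfold rr
    norm_cast
    symm
    refine card_bij' (fun v _ => (a * v.1 - D * b * v.2, a * v.2 + b * v.1))
      (fun v _ => ((a * v.1 + D * b * v.2) / p, (a * v.2 - b * v.1) / p)) ?_ ?_ ?_ ?_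
    · rintro ⟨x, y⟩ h
      rw [mem_rset hD] at h
      rw [mem_filter, mem_rset hD]
      constructor
      · push_cast
        rw [← h, ← hab]; ring
      · refine ⟨y, ?_⟩
        rw [← hab]; ring
    · rintro ⟨x, y⟩ h
      rw [mem_filter, mem_rset hD] at h
      obtain ⟨h1, z, hz⟩ := h
      simp only at hz
      push_cast at h1
      have hd : (p : ℤ) ∣ a * x + D * b * y := by
        apply hpZ.dvd_of_dvd_pow (n := 2)
        refine ⟨p * N - D * p * z ^ 2, ?_⟩
        have : (a * x + D * b * y) ^ 2 + D * (a * y - b * x) ^ 2 = (a ^ 2 + D * b ^ 2) * (x ^ 2 + D * y ^ 2) := by ring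
        rw [hz, hab, h1] at this
        linear_combination this
      obtain ⟨w, hw⟩ := hd
      simp only
      rw [mem_rset hD, hz, hw, Int.mul_ediv_cancel_left _ hp', Int.mul_ediv_cancel_left _ hp']
      have : (a * x + D * b * y) ^ 2 + D * (a * y - b * x) ^ 2 = (a ^ 2 + D * b ^ 2) * (x ^ 2 + D * y ^ 2) := by ring
      rw [hz, hw, hab, h1] at this
      have e : (p : ℤ) * (p * (w ^ 2 + D * z ^ 2)) = p * (p * N) := by linear_combination this
      exact mul_left_cancel₀ hp' (mul_left_cancel₀ hp' e)
    · rintro ⟨x, y⟩ h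
      simp only [Prod.mk.injEq]
      constructor
      · apply Int.ediv_eq_of_eq_mul_right hp'
        rw [← hab]; ring
      · apply Int.ediv_eq_of_eq_mul_right hp'
        rw [← hab]; ring
    · rintro ⟨x, y⟩ h
      rw [mem_filter, mem_rset hD] at h
      obtain ⟨h1, z, hz⟩ := h
      simp only at hz
      push_cast at h1
      have hd : (p : ℤ) ∣ a * x + D * b * y := by
        apply hpZ.dvd_of_dvd_pow (n := 2)
        refine ⟨p * N - D * p * z ^ 2, ?_⟩
        have : (a * x + D * b * y) ^ 2 + D * (a * y - b * x) ^ 2 = (a ^ 2 + D * b ^ 2) * (x ^ 2 + D * y ^ 2) := by ring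
        rw [hz, hab, h1] at this
        linear_combination this
      obtain ⟨w, hw⟩ := hd
      simp only [Prod.mk.injEq]
      rw [hz, hw, Int.mul_ediv_cancel_left _ hp', Int.mul_ediv_cancel_left _ hp']
      constructor
      · apply mul_left_cancel₀ hp'
        linear_combination (-a) * hw + D * b * hz + x * hab
      · apply mul_left_cancel₀ hp'
        linear_combination (-a) * hz - b * hw + y * hab
  have h1 := hA a b hab
  have h2 := hA a (-b) (by rw [neg_sq]; exact hab)
  have hunion : (rset D (p * N)).filter (fun v => (p : ℤ) ∣ a * v.2 - b * v.1) ∪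
      (rset D (p * N)).filter (fun v => (p : ℤ) ∣ a * v.2 - (-b) * v.1) = rset D (p * N) := by
    rw [← filter_or]
    apply filter_true_of_mem
    rintro ⟨x, y⟩ h
    rw [mem_rset hD] at h
    push_cast at h
    apply hpZ.dvd_or_dvd
    refine ⟨y ^ 2 - b ^ 2 * N, ?_⟩
    linear_combination y ^ 2 * hab - b ^ 2 * h
  have hcard := card_union_add_card_inter
    ((rset D (p * N)).filter (fun v => (p : ℤ) ∣ a * v.2 - b * v.1))
    ((rset D (p * N)).filter (fun v => (p : ℤ) ∣ a * v.2 - (-b) * v.1))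
  rw [hunion] at hcard
  have hint : ∀ x y : ℤ, (x, y) ∈ (rset D (p * N)).filter (fun v => (p : ℤ) ∣ a * v.2 - b * v.1) ∩
      (rset D (p * N)).filter (fun v => (p : ℤ) ∣ a * v.2 - (-b) * v.1) ↔
      ((p : ℤ) ∣ x ∧ (p : ℤ) ∣ y) ∧ x ^ 2 + D * y ^ 2 = p * N := by
    intro x y
    rw [mem_inter, mem_filter, mem_filter, mem_rset hD]
    push_cast
    constructor
    · rintro ⟨⟨h1, h2⟩, _, h3⟩
      refine ⟨?_, h1⟩
      have hp2' : ¬ (p : ℤ) ∣ 2 := by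
        intro h
        have : p ∣ 2 := by exact_mod_cast h
        exact hp2 ((Nat.prime_dvd_prime_iff_eq hp Nat.prime_two).1 this)
      have d1 : (p : ℤ) ∣ 2 * (a * y) := by
        have := dvd_add h2 h3
        have e : a * y - b * x + (a * y - -b * x) = 2 * (a * y) := by ring
        rwa [e] at this
      have d2 : (p : ℤ) ∣ 2 * (b * x) := by
        have := dvd_sub h3 h2
        have e : a * y - -b * x - (a * y - b * x) = 2 * (b * x) := by ring
        rwa [e] at this
      exact ⟨(hpZ.dvd_or_dvd ((hpZ.dvd_or_dvd d2).resolve_left hp2')).resolve_left hb,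
        (hpZ.dvd_or_dvd ((hpZ.dvd_or_dvd d1).resolve_left hp2')).resolve_left ha⟩
    · rintro ⟨⟨hx, hy⟩, h⟩
      have u1 := Dvd.dvd.mul_left hx b
      have u2 := Dvd.dvd.mul_left hy a
      have u3 := Dvd.dvd.mul_left hx (-b)
      exact ⟨⟨h, dvd_sub u2 u1⟩, h, dvd_sub u2 u3⟩
  have hi : ((((rset D (p * N)).filter (fun v => (p : ℤ) ∣ a * v.2 - b * v.1) ∩
      (rset D (p * N)).filter (fun v => (p : ℤ) ∣ a * v.2 - (-b) * v.1)).card : ℕ) : ℤ) =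
      if p ∣ N then rr D (N / p) else 0 := by
    split_ifs with hN
    · obtain ⟨M, rfl⟩ := hN
      rw [Nat.mul_div_cancel_left _ hp.pos]
      exact rr_scale D p M hD hp.pos _ hint
    · norm_cast
      rw [card_eq_zero, eq_empty_iff_forall_notMem]
      rintro ⟨x, y⟩ h
      rw [hint] at h
      obtain ⟨⟨⟨x, rfl⟩, ⟨y, rfl⟩⟩, h⟩ := h
      apply hN
      have : (p : ℤ) * (p * (x ^ 2 + D * y ^ 2)) = p * N := by rw [← h]; ring
      have := mul_left_cancel₀ hp' this
      exact_mod_cast (Dvd.intro _ this : (p : ℤ) ∣ N)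
  rw [← hi]
  have : rr D (p * N) = ((rset D (p * N)).card : ℤ) := rfl
  rw [this]
  zify at hcard
  linarith

theorem hecke_inert (D p N : ℕ) (hD : 0 < D) (hp : p.Prime)
    (hs : ¬ IsSquare ((-D : ℤ) : ZMod p)) :
    rr D (p * N) = if p ∣ N then rr D (N / p) else 0 := by
  have hpZ : Prime (p : ℤ) := Nat.prime_iff_prime_int.1 hp
  have hp' : (p : ℤ) ≠ 0 := hpZ.ne_zero
  have : Fact p.Prime := ⟨hp⟩
  have hint : ∀ x y : ℤ, (x, y) ∈ rset D (p * N) ↔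
      ((p : ℤ) ∣ x ∧ (p : ℤ) ∣ y) ∧ x ^ 2 + D * y ^ 2 = p * N := by
    intro x y
    rw [mem_rset hD]
    push_cast
    refine ⟨fun h => ⟨?_, h⟩, fun h => h.2⟩
    have hz : (x : ZMod p) ^ 2 + D * (y : ZMod p) ^ 2 = 0 := by
      have := congrArg (Int.cast : ℤ → ZMod p) h
      push_cast at this
      rw [this]; simp
    have hy : (y : ZMod p) = 0 := by
      by_contra hy
      apply hs
      refine ⟨x / y, ?_⟩
      push_cast
      field_simp
      linear_combination -hz
    have hx : (x : ZMod p) = 0 := by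
      rw [hy] at hz
      simpa using hz
    exact ⟨(ZMod.intCast_zmod_eq_zero_iff_dvd _ _).1 hx, (ZMod.intCast_zmod_eq_zero_iff_dvd _ _).1 hy⟩
  split_ifs with hN
  · obtain ⟨M, rfl⟩ := hN
    rw [Nat.mul_div_cancel_left _ hp.pos]
    exact rr_scale D p M hD hp.pos _ hint
  · unfold rr
    norm_cast
    rw [card_eq_zero, eq_empty_iff_forall_notMem]
    rintro ⟨x, y⟩ h
    rw [hint] at h
    obtain ⟨⟨⟨x, rfl⟩, ⟨y, rfl⟩⟩, h⟩ := h
    apply hN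
    have : (p : ℤ) * (p * (x ^ 2 + D * y ^ 2)) = p * N := by rw [← h]; ring
    have := mul_left_cancel₀ hp' this
    exact_mod_cast (Dvd.intro _ this : (p : ℤ) ∣ N)

theorem hecke_three (N : ℕ) : rr 3 (3 * N) = rr 3 N := by
  unfold rr
  norm_cast
  refine card_bij' (fun v _ => (v.2, v.1 / 3)) (fun v _ => (3 * v.2, v.1)) ?_ ?_ ?_ ?_
  · rintro ⟨x, y⟩ h
    rw [mem_rset (by norm_num)] at h ⊢
    push_cast at h ⊢
    have : 3 ∣ x ^ 2 := ⟨N - y ^ 2, by linarith⟩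
    obtain ⟨z, rfl⟩ := Int.prime_three.dvd_of_dvd_pow this
    rw [Int.mul_ediv_cancel_left _ (by norm_num)]
    linarith
  · rintro ⟨x, y⟩ h
    rw [mem_rset (by norm_num)] at h ⊢
    push_cast at h ⊢
    linarith
  · rintro ⟨x, y⟩ h
    rw [mem_rset (by norm_num)] at h
    push_cast at h
    have : 3 ∣ x ^ 2 := ⟨N - y ^ 2, by linarith⟩
    obtain ⟨z, rfl⟩ := Int.prime_three.dvd_of_dvd_pow this
    simp
  · rintro ⟨x, y⟩ h
    simp

theorem hecke (D p N : ℕ) (hD : D = 2 ∨ D = 3) (hp : p.Prime) (hp2 : p ≠ 2) :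
    rr D (p * N) = (1 + jacobiSym (-D) p) * rr D N -
      jacobiSym (-D) p * if p ∣ N then rr D (N / p) else 0 := by
  have : Fact p.Prime := ⟨hp⟩
  have hD0 : 0 < D := by omega
  rw [← jacobiSym.legendreSym.to_jacobiSym]
  by_cases hz : ((-D : ℤ) : ZMod p) = 0
  · rw [(legendreSym.eq_zero_iff p (-D)).2 hz]
    have hpD : p ∣ D := by
      have := (ZMod.intCast_zmod_eq_zero_iff_dvd _ _).1 hz
      rw [dvd_neg] at this
      exact_mod_cast this
    rcases hD with rfl | rfl
    · exact absurd ((Nat.prime_dvd_prime_iff_eq hp Nat.prime_two).1 hpD) hp2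
    · obtain rfl := (Nat.prime_dvd_prime_iff_eq hp Nat.prime_three).1 hpD
      rw [hecke_three]; ring
  · by_cases hs : IsSquare ((-D : ℤ) : ZMod p)
    · rw [(legendreSym.eq_one_iff p hz).2 hs]
      obtain ⟨a, b, hab⟩ := rep_of_sq D p hp hp2 hD hs
      have hpZ : Prime (p : ℤ) := Nat.prime_iff_prime_int.1 hp
      have hpD : ¬ (p : ℤ) ∣ D := by
        intro h
        apply hz
        rw [ZMod.intCast_zmod_eq_zero_iff_dvd, dvd_neg]; exact h
      have hp1 : ∀ z : ℤ, ¬ (p : ℤ) = p * (p * z) := by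
        intro z h
        have h' : (p : ℤ) * 1 = p * (p * z) := by rw [mul_one]; exact h
        have := mul_left_cancel₀ hpZ.ne_zero h'
        exact hpZ.not_isUnit (IsUnit.of_mul_eq_one z this.symm)
      have ha : ¬ (p : ℤ) ∣ a := by
        intro ha
        have h1 : (p : ℤ) ∣ D * b ^ 2 := by
          have e : (D : ℤ) * b ^ 2 = p - a ^ 2 := by linarith
          rw [e]
          exact dvd_sub dvd_rfl (Dvd.dvd.pow ha two_ne_zero)
        have hb := hpZ.dvd_of_dvd_pow ((hpZ.dvd_or_dvd h1).resolve_left hpD)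
        obtain ⟨u, rfl⟩ := ha
        obtain ⟨v, rfl⟩ := hb
        exact hp1 (u ^ 2 + D * v ^ 2) (by linear_combination -hab)
      have hb : ¬ (p : ℤ) ∣ b := by
        intro hb
        have h1 : (p : ℤ) ∣ a ^ 2 := by
          have e : a ^ 2 = p - D * b ^ 2 := by linarith
          rw [e]
          exact dvd_sub dvd_rfl (Dvd.dvd.mul_left (Dvd.dvd.pow hb two_ne_zero) _)
        exact ha (hpZ.dvd_of_dvd_pow h1)
      rw [hecke_split D p N hD0 hp hp2 a b hab ha hb]; ring
    · rw [(legendreSym.eq_neg_one_iff p).2 hs, hecke_inert D p N hD0 hp hs]; ring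

def dsum (c : ℕ → ℤ) (n : ℕ) : ℤ := ∑ d ∈ n.divisors, c d

theorem dsum_p (c : ℕ → ℤ) (hc : ∀ x y, c (x * y) = c x * c y) (p n : ℕ) (hp : p.Prime) (hn : n ≠ 0) :
    ∑ d ∈ (p * n).divisors.filter (fun d => p ∣ d), c d = c p * dsum c n := by
  unfold dsum
  rw [mul_sum]
  symm
  refine sum_bij' (fun d _ => p * d) (fun d _ => d / p) ?_ ?_ ?_ ?_ ?_
  · intro d hd
    rw [Nat.mem_divisors] at hd
    rw [mem_filter, Nat.mem_divisors]
    exact ⟨⟨Nat.mul_dvd_mul_left p hd.1, mul_ne_zero hp.ne_zero hn⟩, by simp⟩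
  · intro d hd
    rw [mem_filter, Nat.mem_divisors] at hd
    obtain ⟨⟨h1, _⟩, d, rfl⟩ := hd
    rw [Nat.mul_div_cancel_left _ hp.pos, Nat.mem_divisors]
    exact ⟨Nat.dvd_of_mul_dvd_mul_left hp.pos h1, hn⟩
  · intro d hd
    exact Nat.mul_div_cancel_left _ hp.pos
  · intro d hd
    rw [mem_filter] at hd
    exact Nat.mul_div_cancel' hd.2
  · intro d hd
    rw [hc]

theorem dsum_rec (c : ℕ → ℤ) (hc : ∀ x y, c (x * y) = c x * c y) (p n : ℕ) (hp : p.Prime) (hn : n ≠ 0) :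
    dsum c (p * n) = (1 + c p) * dsum c n - c p * if p ∣ n then dsum c (n / p) else 0 := by
  have h1 : dsum c (p * n) = _ := (sum_filter_add_sum_filter_not (p * n).divisors (fun d => p ∣ d) c).symm
  have h2 : dsum c n = _ := (sum_filter_add_sum_filter_not n.divisors (fun d => p ∣ d) c).symm
  have h3 : (p * n).divisors.filter (fun d => ¬ p ∣ d) = n.divisors.filter (fun d => ¬ p ∣ d) := by
    ext d
    simp only [mem_filter, Nat.mem_divisors]
    constructor
    · rintro ⟨⟨h1, _⟩, h2⟩
      exact ⟨⟨(Nat.Coprime.dvd_of_dvd_mul_left (((Nat.Prime.coprime_iff_not_dvd hp).2 h2).symm) h1), hn⟩, h2⟩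
    · rintro ⟨⟨h1, _⟩, h2⟩
      exact ⟨⟨Dvd.dvd.mul_left h1 _, mul_ne_zero hp.ne_zero hn⟩, h2⟩
  have h4 : ∑ d ∈ n.divisors.filter (fun d => p ∣ d), c d = c p * if p ∣ n then dsum c (n / p) else 0 := by
    split_ifs with h
    · obtain ⟨k, rfl⟩ := h
      rw [Nat.mul_div_cancel_left _ hp.pos]
      exact dsum_p c hc p k hp (by rintro rfl; simp at hn)
    · rw [mul_zero]
      refine sum_eq_zero ?_
      intro d hd
      rw [mem_filter, Nat.mem_divisors] at hd
      exact absurd (hd.2.trans hd.1.1) h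
  rw [h3, dsum_p c hc p n hp hn] at h1
  linarith

theorem rec_unique (R c : ℕ → ℤ) (hc : ∀ x y, c (x * y) = c x * c y) (hc1 : c 1 = 1)
    (hR : ∀ p n, p.Prime → p ≠ 2 → R (p * n) = (1 + c p) * R n - c p * if p ∣ n then R (n / p) else 0) :
    ∀ n, n % 2 = 1 → R n = R 1 * dsum c n := by
  intro n
  induction n using Nat.strong_induction_on with
  | _ n ih =>
    intro hn
    by_cases h1 : n = 1
    · subst h1
      simp [dsum, hc1]
    · have hp := Nat.minFac_prime h1
      obtain ⟨k, hk⟩ := Nat.minFac_dvd n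
      generalize n.minFac = p at hp hk
      subst hk
      have hk0 : k ≠ 0 := by rintro rfl; simp at hn
      have hkp : 0 < k := Nat.pos_of_ne_zero hk0
      have hpk : p % 2 = 1 ∧ k % 2 = 1 := by
        have := Nat.odd_mul.1 (Nat.odd_iff.2 hn)
        exact ⟨Nat.odd_iff.1 this.1, Nat.odd_iff.1 this.2⟩
      have i1 := ih k (by nlinarith [hp.two_le]) hpk.2
      rw [hR p k hp (by omega), dsum_rec c hc p k hp hk0, i1]
      split_ifs with hd
      · obtain ⟨l, rfl⟩ := hd
        have hl0 : 0 < l := Nat.pos_of_ne_zero (by rintro rfl; simp at hkp)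
        have i2 := ih l (by nlinarith [hp.two_le, Nat.mul_pos hp.pos hl0])
          (Nat.odd_iff.1 (Nat.odd_mul.1 (Nat.odd_iff.2 hpk.2)).2)
        rw [Nat.mul_div_cancel_left _ hp.pos, i2]; ring
      · ring

theorem hecke_s (D s p n : ℕ) (hs : s = 1 ∨ s = 4) (hD : D = 2 ∨ D = 3) (hp : p.Prime) (hp2 : p ≠ 2) :
    rr D (s * (p * n)) = (1 + jacobiSym (-D) p) * rr D (s * n) -
      jacobiSym (-D) p * if p ∣ n then rr D (s * (n / p)) else 0 := by
  have e : s * (p * n) = p * (s * n) := by ring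
  rw [e, hecke D p _ hD hp hp2]
  have hps : p.Coprime s := by
    rcases hs with rfl | rfl
    · simp
    · have : (4 : ℕ) = 2 ^ 2 := by norm_num
      rw [this]
      exact Nat.Coprime.pow_right _ ((Nat.coprime_primes hp Nat.prime_two).2 hp2)
  have h1 : p ∣ s * n ↔ p ∣ n := ⟨hps.dvd_of_dvd_mul_left, fun h => Dvd.dvd.mul_left h _⟩
  simp only [h1]
  split_ifs with h
  · rw [Nat.mul_div_assoc _ h]
  · rfl

def psiN (x : ℕ) : ℤ := psi x
def chiN (x : ℕ) : ℤ := chi x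

theorem jm2 (p : ℕ) (hp : p % 2 = 1) : jacobiSym (-2) p = psiN p := by
  have hodd : Odd p := Nat.odd_iff.2 hp
  rw [jacobiSym.at_neg_two hodd]
  simp [psi, psiN]

theorem jm3 (p : ℕ) (hp : p % 2 = 1) : jacobiSym (-3) p = chiN p := by
  have hodd : Odd p := Nat.odd_iff.2 hp
  rw [chiN, ← jac3, jacobiSym.neg _ hodd]
  have h4 : p % 4 = 1 ∨ p % 4 = 3 := by omega
  rcases h4 with h4 | h4
  · rw [ZMod.χ₄_nat_one_mod_four h4, one_mul]
    exact jacobiSym.quadratic_reciprocity_one_mod_four' (by decide) h4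
  · rw [ZMod.χ₄_nat_three_mod_four h4]
    have := jacobiSym.quadratic_reciprocity_three_mod_four (a := 3) (b := p) (by norm_num) h4
    push_cast at this
    rw [this]; ring

theorem psiN_mul (x y : ℕ) : psiN (x * y) = psiN x * psiN y := by
  unfold psiN; push_cast; exact psi_mul _ _
theorem chiN_mul (x y : ℕ) : chiN (x * y) = chiN x * chiN y := by
  unfold chiN; push_cast; exact chi_mul _ _

theorem rr2_base : rr 2 1 = 2 := by
  have : rset 2 1 = {(1, 0), (-1, 0)} := by
    ext ⟨x, y⟩
    rw [mem_rset (by norm_num)]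
    simp only [mem_insert, mem_singleton, Prod.mk.injEq]
    push_cast
    constructor
    · intro h
      have hy : y = 0 := by by_contra hy; have : 0 < y ^ 2 := by positivity
                            nlinarith [sq_nonneg x]
      subst hy
      have : x ^ 2 = 1 := by linarith
      rcases sq_eq_one_iff.1 this with h | h <;> simp [h]
    · rintro (⟨rfl, rfl⟩ | ⟨rfl, rfl⟩) <;> norm_num
  rw [rr, this]; rfl

theorem rr3_base : rr 3 1 = 2 := by
  have : rset 3 1 = {(1, 0), (-1, 0)} := by
    ext ⟨x, y⟩
    rw [mem_rset (by norm_num)]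
    simp only [mem_insert, mem_singleton, Prod.mk.injEq]
    push_cast
    constructor
    · intro h
      have hy : y = 0 := by by_contra hy; have : 0 < y ^ 2 := by positivity
                            nlinarith [sq_nonneg x]
      subst hy
      have : x ^ 2 = 1 := by linarith
      rcases sq_eq_one_iff.1 this with h | h <;> simp [h]
    · rintro (⟨rfl, rfl⟩ | ⟨rfl, rfl⟩) <;> norm_num
  rw [rr, this]; rfl

theorem rr3_base4 : rr 3 4 = 6 := by
  have : rset 3 4 = {(2, 0), (-2, 0), (1, 1), (1, -1), (-1, 1), (-1, -1)} := by
    ext ⟨x, y⟩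
    rw [mem_rset (by norm_num)]
    simp only [mem_insert, mem_singleton, Prod.mk.injEq]
    push_cast
    constructor
    · intro h
      have h1 : y ≤ 1 := by nlinarith [sq_nonneg x]
      have h2 : -1 ≤ y := by nlinarith [sq_nonneg x]
      have h3 : x ≤ 2 := by nlinarith [sq_nonneg y]
      have h4 : -2 ≤ x := by nlinarith [sq_nonneg y]
      interval_cases x <;> interval_cases y <;> simp_all
    · rintro (⟨rfl, rfl⟩ | ⟨rfl, rfl⟩ | ⟨rfl, rfl⟩ | ⟨rfl, rfl⟩ | ⟨rfl, rfl⟩ | ⟨rfl, rfl⟩) <;> norm_num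
  rw [rr, this]; rfl

theorem rr2_eq (n : ℕ) (hn : n % 2 = 1) : rr 2 n = 2 * dsum psiN n := by
  rw [← rr2_base]
  refine rec_unique (rr 2) psiN psiN_mul (by decide) ?_ n hn
  intro p n hp hp2
  have hodd := hp.eq_two_or_odd.resolve_left hp2
  have := hecke_s 2 1 p n (Or.inl rfl) (Or.inl rfl) hp hp2
  simp only [one_mul] at this
  rw [this]
  push_cast
  rw [jm2 p hodd]

theorem rr3_eq (n : ℕ) (hn : n % 2 = 1) : rr 3 n = 2 * dsum chiN n := by
  rw [← rr3_base]
  refine rec_unique (rr 3) chiN chiN_mul (by decide) ?_ n hn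
  intro p n hp hp2
  have hodd := hp.eq_two_or_odd.resolve_left hp2
  have := hecke_s 3 1 p n (Or.inl rfl) (Or.inr rfl) hp hp2
  simp only [one_mul] at this
  rw [this]
  push_cast
  rw [jm3 p hodd]

theorem rr3_eq4 (n : ℕ) (hn : n % 2 = 1) : rr 3 (4 * n) = 6 * dsum chiN n := by
  rw [← rr3_base4]
  refine rec_unique (fun n => rr 3 (4 * n)) chiN chiN_mul (by decide) ?_ n hn
  intro p n hp hp2
  have hodd := hp.eq_two_or_odd.resolve_left hp2
  have := hecke_s 3 4 p n (Or.inr rfl) (Or.inr rfl) hp hp2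
  rw [this]
  push_cast
  rw [jm3 p hodd]


noncomputable def KL (m : ℕ) : Finset (ℕ × ℕ) :=
  ((range (m + 1)) ×ˢ (range (m + 1))).filter (fun p => 4 * p.1 + 3 * p.2 = m ∧ 0 < p.1)

theorem mem_KL {m k l : ℕ} : (k, l) ∈ KL m ↔ 4 * k + 3 * l = m ∧ 0 < k := by
  simp only [KL, mem_filter, mem_product, mem_range]
  constructor
  · exact fun h => h.2
  · intro h; exact ⟨⟨by omega, by omega⟩, h⟩

theorem sq8 (x : ℤ) : (x % 2 = 1 ∧ x ^ 2 % 8 = 1) ∨ (x % 4 = 2 ∧ x ^ 2 % 8 = 4) ∨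
    (x % 4 = 0 ∧ x ^ 2 % 8 = 0) := by
  have : x % 8 = 0 ∨ x % 8 = 1 ∨ x % 8 = 2 ∨ x % 8 = 3 ∨ x % 8 = 4 ∨ x % 8 = 5 ∨ x % 8 = 6 ∨ x % 8 = 7 := by
    omega
  have h2 : x ^ 2 % 8 = ((x % 8) * (x % 8)) % 8 := by rw [pow_two, Int.mul_emod]
  rcases this with h | h | h | h | h | h | h | h <;> rw [h] at h2 <;> omega

theorem dsum_psi_zero (l : ℕ) (hl : l % 8 = 7) : dsum psiN l = 0 := by
  have h := rr2_eq l (by omega)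
  have : rset 2 l = ∅ := by
    rw [eq_empty_iff_forall_notMem]
    rintro ⟨x, y⟩ h
    rw [mem_rset (by norm_num)] at h
    push_cast at h
    have := sq8 x
    have := sq8 y
    omega
  rw [rr, this] at h
  simp at h
  exact h

theorem Qsum (m : ℕ) (hm : m % 8 = 5) :
    ∑ v ∈ (Q m).filter (fun v => 4 ∣ v.1), (if 3 ∣ v.2.1 then chi v.1 * psi v.2.1 else 0) =
    ∑ p ∈ KL m, dsum chiN p.1 * dsum psiN p.2 := by
  have e : ∀ p ∈ KL m, dsum chiN p.1 * dsum psiN p.2 =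
     ∑ q ∈ p.1.divisors ×ˢ p.2.divisors, chiN q.1 * psiN q.2 := by
    intro p _
    rw [dsum, dsum, sum_mul_sum, sum_product]
  rw [sum_congr rfl e, sum_sigma', ← sum_filter]
  symm
  refine sum_bij' (fun s _ => ((4 * s.2.1 : ℤ), (3 * s.2.2 : ℤ), ((s.1.1 / s.2.1 : ℕ) : ℤ), ((s.1.2 / s.2.2 : ℕ) : ℤ)))
    (fun v _ => ⟨((v.1 / 4).toNat * v.2.2.1.toNat, (v.2.1 / 3).toNat * v.2.2.2.toNat),
      ((v.1 / 4).toNat, (v.2.1 / 3).toNat)⟩) ?_ ?_ ?_ ?_ ?_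
  · rintro ⟨⟨k, l⟩, ⟨d, e⟩⟩ h
    simp only [mem_sigma, mem_KL, mem_product, Nat.mem_divisors] at h
    obtain ⟨⟨h1, h2⟩, ⟨⟨u, rfl⟩, _⟩, ⟨⟨w, rfl⟩, h4⟩⟩ := h
    have hd : 0 < d := Nat.pos_of_ne_zero (by rintro rfl; simp at h2)
    have hu : 0 < u := Nat.pos_of_ne_zero (by rintro rfl; simp at h2)
    have he : 0 < e := Nat.pos_of_ne_zero (by rintro rfl; simp at h4)
    have hw : 0 < w := Nat.pos_of_ne_zero (by rintro rfl; simp at h4)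
    simp only [mem_filter, mem_Q, Nat.mul_div_cancel_left _ hd, Nat.mul_div_cancel_left _ he]
    refine ⟨⟨⟨by omega, by omega, by omega, by omega, ?_⟩, by simp⟩, by simp⟩
    rw [← h1]; push_cast; ring
  · rintro ⟨a, b, x, y⟩ h
    simp only [mem_filter, mem_Q] at h
    obtain ⟨⟨⟨h1, h2, h3, h4, h5⟩, ⟨a, rfl⟩⟩, ⟨b, rfl⟩⟩ := h
    have ea : 4 * a / 4 = a := by omega
    have eb : 3 * b / 3 = b := by omega
    simp only [mem_sigma, mem_KL, mem_product, Nat.mem_divisors, ea, eb]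
    have ha : 0 < a := by omega
    have hb : 0 < b := by omega
    lift a to ℕ using ha.le
    lift b to ℕ using hb.le
    lift x to ℕ using h3.le
    lift y to ℕ using h4.le
    simp only [Int.toNat_natCast]
    have q1 : 0 < a * x := Nat.mul_pos (by omega) (by omega)
    have q2 : 0 < b * y := Nat.mul_pos (by omega) (by omega)
    refine ⟨⟨?_, q1⟩, ⟨by simp, q1.ne'⟩, ⟨by simp, q2.ne'⟩⟩
    zify; rw [← h5]; ring
  · rintro ⟨⟨k, l⟩, ⟨d, e⟩⟩ h
    simp only [mem_sigma, mem_KL, mem_product, Nat.mem_divisors] at h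
    obtain ⟨⟨h1, h2⟩, ⟨hd, _⟩, ⟨he, _⟩⟩ := h
    have ea : (4 * (d : ℤ)) / 4 = d := by omega
    have eb : (3 * (e : ℤ)) / 3 = e := by omega
    simp only [ea, eb, Int.toNat_natCast, Nat.mul_div_cancel' hd, Nat.mul_div_cancel' he]
  · rintro ⟨a, b, x, y⟩ h
    simp only [mem_filter, mem_Q] at h
    obtain ⟨⟨⟨h1, h2, h3, h4, h5⟩, ⟨a, rfl⟩⟩, ⟨b, rfl⟩⟩ := h
    have ea : 4 * a / 4 = a := by omega
    have eb : 3 * b / 3 = b := by omega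
    have ha : 0 < a := by omega
    have hb : 0 < b := by omega
    simp only [ea, eb]
    rw [Nat.mul_div_cancel_left _ (by omega), Nat.mul_div_cancel_left _ (by omega)]
    simp only [Prod.mk.injEq]
    omega
  · rintro ⟨⟨k, l⟩, ⟨d, e⟩⟩ h
    simp only [chiN, psiN]
    have h4 : (4 : ZMod 3) = 1 := by decide
    push_cast
    rw [h4, one_mul, psi_mul, show psi 3 = 1 by rfl, one_mul]

noncomputable def NF (m : ℕ) : Finset Z4 :=
  ((Icc (-(m : ℤ)) m) ×ˢ (Icc (-(m : ℤ)) m) ×ˢ (Icc (-(m : ℤ)) m) ×ˢ (Icc (-(m : ℤ)) m)).filter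
    (fun v => v.1 ^ 2 + 3 * v.2.1 ^ 2 + 3 * v.2.2.1 ^ 2 + 6 * v.2.2.2 ^ 2 = m)

theorem mem_NF {m : ℕ} {x y z w : ℤ} : (x, y, z, w) ∈ NF m ↔
    x ^ 2 + 3 * y ^ 2 + 3 * z ^ 2 + 6 * w ^ 2 = m := by
  simp only [NF, mem_filter, mem_product, mem_Icc]
  refine ⟨fun h => h.2, fun h => ⟨⟨?_, ?_, ?_, ?_⟩, h⟩⟩ <;> apply sq_le_bd <;>
    nlinarith [sq_nonneg x, sq_nonneg y, sq_nonneg z, sq_nonneg w]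

noncomputable def RF (m : ℕ) : Finset Z4 :=
  ((Icc (-(m : ℤ)) m) ×ˢ (Icc (-(m : ℤ)) m) ×ˢ (Icc (-(m : ℤ)) m) ×ˢ (Icc (-(m : ℤ)) m)).filter
    (fun v => v.1 ^ 2 + 6 * v.2.1 ^ 2 + 6 * v.2.2.1 ^ 2 + 6 * v.2.2.2 ^ 2 = m)

theorem mem_RF {m : ℕ} {x y z w : ℤ} : (x, y, z, w) ∈ RF m ↔
    x ^ 2 + 6 * y ^ 2 + 6 * z ^ 2 + 6 * w ^ 2 = m := by
  simp only [RF, mem_filter, mem_product, mem_Icc]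
  refine ⟨fun h => h.2, fun h => ⟨⟨?_, ?_, ?_, ?_⟩, h⟩⟩ <;> apply sq_le_bd <;>
    nlinarith [sq_nonneg x, sq_nonneg y, sq_nonneg z, sq_nonneg w]

/-- all odd -/
noncomputable def T1 (m : ℕ) : Finset Z4 :=
  (NF m).filter (fun v => v.1 % 2 = 1 ∧ v.2.1 % 2 = 1 ∧ v.2.2.1 % 2 = 1 ∧ v.2.2.2 % 2 = 1)
noncomputable def T2 (m : ℕ) : Finset Z4 :=
  (NF m).filter (fun v => v.2.1 % 2 = v.2.2.1 % 2 ∧ v.2.2.2 % 2 = 0)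
noncomputable def T3 (m : ℕ) : Finset Z4 :=
  (NF m).filter (fun v => v.2.1 % 2 = 0 ∧ v.2.2.1 % 2 = 1)
noncomputable def T4 (m : ℕ) : Finset Z4 :=
  (NF m).filter (fun v => v.2.1 % 2 = 1 ∧ v.2.2.1 % 2 = 0)

theorem NF_card (m : ℕ) (hm : m % 8 = 5) :
    (NF m).card = (T1 m).card + (T2 m).card + (T3 m).card + (T4 m).card := by
  simp only [T1, T2, T3, T4, card_filter, card_eq_sum_ones (NF m), ← sum_add_distrib]
  refine sum_congr rfl ?_
  rintro ⟨x, y, z, w⟩ h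
  rw [mem_NF] at h
  have h1 := sq8 x
  have h2 := sq8 y
  have h3 := sq8 z
  have h4 := sq8 w
  simp only
  rcases Int.emod_two_eq_zero_or_one y with hy | hy <;>
  rcases Int.emod_two_eq_zero_or_one z with hz | hz <;>
  rcases Int.emod_two_eq_zero_or_one w with hw | hw <;>
  rcases Int.emod_two_eq_zero_or_one x with hx | hx <;>
  simp [hy, hz, hw, hx] <;> omega

theorem T34 (m : ℕ) : (T4 m).card = (T3 m).card := by
  refine card_bij' (fun v _ => (v.1, v.2.2.1, v.2.1, v.2.2.2)) (fun v _ => (v.1, v.2.2.1, v.2.1, v.2.2.2)) ?_ ?_ ?_ ?_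
  · rintro ⟨x, y, z, w⟩ h
    simp only [T3, T4, mem_filter, mem_NF] at h ⊢
    exact ⟨by linarith [h.1], h.2.2, h.2.1⟩
  · rintro ⟨x, y, z, w⟩ h
    simp only [T3, T4, mem_filter, mem_NF] at h ⊢
    exact ⟨by linarith [h.1], h.2.2, h.2.1⟩
  · intros; rfl
  · intros; rfl

theorem T12 (m : ℕ) (hm : m % 8 = 5) : (T1 m).card = 2 * (T2 m).card := by
  have b1 : (T1 m).card = ((RF m).filter (fun v => v.2.2.2 % 2 = 1)).card := by
    refine card_bij' (fun v _ => (v.1, (v.2.1 + v.2.2.1) / 2, (v.2.1 - v.2.2.1) / 2, v.2.2.2))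
      (fun v _ => (v.1, v.2.1 + v.2.2.1, v.2.1 - v.2.2.1, v.2.2.2)) ?_ ?_ ?_ ?_
    · rintro ⟨x, y, z, w⟩ h
      simp only [T1, mem_filter, mem_NF, mem_RF] at h ⊢
      obtain ⟨h1, h2, h3, h4, h5⟩ := h
      refine ⟨?_, h5⟩
      obtain ⟨u, hu⟩ : ∃ u, y + z = 2 * u := ⟨(y + z) / 2, by omega⟩
      obtain ⟨v, rfl⟩ : ∃ v, y = u + v := ⟨y - u, by ring⟩
      obtain rfl : z = u - v := by linarith
      have e1 : (u + v + (u - v)) / 2 = u := by omega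
      have e2 : (u + v - (u - v)) / 2 = v := by omega
      rw [e1, e2, ← h1]; ring
    · rintro ⟨x, u, v, w⟩ h
      simp only [T1, mem_filter, mem_NF, mem_RF] at h ⊢
      obtain ⟨h1, h2⟩ := h
      have i1 := sq8 x
      have i2 := sq8 u
      have i3 := sq8 v
      have i4 := sq8 w
      refine ⟨by rw [← h1]; ring, by omega, by omega, by omega, h2⟩
    · rintro ⟨x, y, z, w⟩ h
      simp only [T1, mem_filter, mem_NF] at h
      refine Prod.ext rfl (Prod.ext ?_ (Prod.ext ?_ rfl)) <;> simp only <;> omega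
    · rintro ⟨x, u, v, w⟩ h
      refine Prod.ext rfl (Prod.ext ?_ (Prod.ext ?_ rfl)) <;> simp only <;> omega
  have b2 : (T2 m).card = ((RF m).filter (fun v => v.2.2.2 % 2 = 0)).card := by
    refine card_bij' (fun v _ => (v.1, (v.2.1 + v.2.2.1) / 2, (v.2.1 - v.2.2.1) / 2, v.2.2.2))
      (fun v _ => (v.1, v.2.1 + v.2.2.1, v.2.1 - v.2.2.1, v.2.2.2)) ?_ ?_ ?_ ?_
    · rintro ⟨x, y, z, w⟩ h
      simp only [T2, mem_filter, mem_NF, mem_RF] at h ⊢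
      obtain ⟨h1, h2, h3⟩ := h
      refine ⟨?_, h3⟩
      obtain ⟨u, hu⟩ : ∃ u, y + z = 2 * u := ⟨(y + z) / 2, by omega⟩
      obtain ⟨v, rfl⟩ : ∃ v, y = u + v := ⟨y - u, by ring⟩
      obtain rfl : z = u - v := by linarith
      have e1 : (u + v + (u - v)) / 2 = u := by omega
      have e2 : (u + v - (u - v)) / 2 = v := by omega
      rw [e1, e2, ← h1]; ring
    · rintro ⟨x, u, v, w⟩ h
      simp only [T2, mem_filter, mem_NF, mem_RF] at h ⊢
      obtain ⟨h1, h2⟩ := h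
      refine ⟨by rw [← h1]; ring, by omega, h2⟩
    · rintro ⟨x, y, z, w⟩ h
      simp only [T2, mem_filter, mem_NF] at h
      refine Prod.ext rfl (Prod.ext ?_ (Prod.ext ?_ rfl)) <;> simp only <;> omega
    · rintro ⟨x, u, v, w⟩ h
      refine Prod.ext rfl (Prod.ext ?_ (Prod.ext ?_ rfl)) <;> simp only <;> omega
  have b3 : ((RF m).filter (fun v => v.2.2.2 % 2 = 0)).card = ((RF m).filter (fun v => v.2.1 % 2 = 0)).card := by
    refine card_bij' (fun v _ => (v.1, v.2.2.2, v.2.2.1, v.2.1)) (fun v _ => (v.1, v.2.2.2, v.2.2.1, v.2.1)) ?_ ?_ ?_ ?_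
    · rintro ⟨x, y, z, w⟩ h
      simp only [mem_filter, mem_RF] at h ⊢
      exact ⟨by linarith [h.1], h.2⟩
    · rintro ⟨x, y, z, w⟩ h
      simp only [mem_filter, mem_RF] at h ⊢
      exact ⟨by linarith [h.1], h.2⟩
    · intros; rfl
    · intros; rfl
  have b4 : ((RF m).filter (fun v => v.2.2.2 % 2 = 0)).card = ((RF m).filter (fun v => v.2.2.1 % 2 = 0)).card := by
    refine card_bij' (fun v _ => (v.1, v.2.1, v.2.2.2, v.2.2.1)) (fun v _ => (v.1, v.2.1, v.2.2.2, v.2.2.1)) ?_ ?_ ?_ ?_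
    · rintro ⟨x, y, z, w⟩ h
      simp only [mem_filter, mem_RF] at h ⊢
      exact ⟨by linarith [h.1], h.2⟩
    · rintro ⟨x, y, z, w⟩ h
      simp only [mem_filter, mem_RF] at h ⊢
      exact ⟨by linarith [h.1], h.2⟩
    · intros; rfl
    · intros; rfl
  have b5 : ((RF m).filter (fun v => v.2.2.2 % 2 = 1)).card =
     ((RF m).filter (fun v => v.2.1 % 2 = 0)).card + ((RF m).filter (fun v => v.2.2.1 % 2 = 0)).card := by
    simp only [card_filter, ← sum_add_distrib]
    refine sum_congr rfl ?_
    rintro ⟨x, y, z, w⟩ h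
    rw [mem_RF] at h
    have h1 := sq8 x
    have h2 := sq8 y
    have h3 := sq8 z
    have h4 := sq8 w
    simp only
    rcases Int.emod_two_eq_zero_or_one y with hy | hy <;>
    rcases Int.emod_two_eq_zero_or_one z with hz | hz <;>
    rcases Int.emod_two_eq_zero_or_one w with hw | hw <;>
    simp [hy, hz, hw] <;> omega
  omega


theorem ucard (k : ℕ) (hk : k % 2 = 1) :
    (((rset 3 (4 * k)).filter (fun v => v.1 % 2 = 1)).card : ℤ) = rr 3 (4 * k) - rr 3 k := by
  have h1 := rr_scale 3 2 k (by norm_num) (by norm_num) ((rset 3 (4 * k)).filter (fun v => ¬ v.1 % 2 = 1)) (by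
    intro x y
    rw [mem_filter, mem_rset (by norm_num)]
    push_cast
    have i1 := sq8 x
    have i2 := sq8 y
    constructor
    · rintro ⟨h1, h2⟩
      refine ⟨⟨by omega, by omega⟩, by linarith⟩
    · rintro ⟨⟨h1, h2⟩, h3⟩
      refine ⟨by linarith, by omega⟩)
  have h2 := card_filter_add_card_filter_not (s := rset 3 (4 * k)) (fun v => v.1 % 2 = 1)
  rw [← h1, rr]
  omega

theorem T3card (m : ℕ) (hm : m % 8 = 5) :
    ((T3 m).card : ℤ) = ∑ p ∈ (KL m).filter (fun p => p.1 % 2 = 1), rr 3 p.1 * rr 2 p.2 := by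
  unfold rr
  simp only [← Nat.cast_mul, ← card_product]
  rw [← Nat.cast_sum, ← card_sigma]
  norm_cast
  refine card_bij' (fun v _ => (⟨(((v.1 / 2) ^ 2 + 3 * (v.2.1 / 2) ^ 2).toNat, (v.2.2.1 ^ 2 + 2 * v.2.2.2 ^ 2).toNat),
      ((v.1 / 2, v.2.1 / 2), (v.2.2.1, v.2.2.2))⟩ : (_ : ℕ × ℕ) × ((ℤ × ℤ) × (ℤ × ℤ))))
    (fun s _ => (2 * s.2.1.1, 2 * s.2.1.2, s.2.2.1, s.2.2.2)) ?_ ?_ ?_ ?_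
  · rintro ⟨x, y, z, w⟩ h
    simp only [T3, mem_filter, mem_NF] at h
    obtain ⟨h1, h2, h3⟩ := h
    have i1 := sq8 x
    have i2 := sq8 y
    have i3 := sq8 z
    have i4 := sq8 w
    obtain ⟨x, rfl⟩ : ∃ x', x = 2 * x' := ⟨x / 2, by omega⟩
    obtain ⟨y, rfl⟩ : ∃ x', y = 2 * x' := ⟨y / 2, by omega⟩
    have e1 : 2 * x / 2 = x := by omega
    have e2 : 2 * y / 2 = y := by omega
    simp only [mem_sigma, mem_filter, mem_product, mem_KL, mem_rset (by norm_num : 0 < 3), mem_rset (by norm_num : 0 < 2), e1, e2]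
    have k0 : 0 ≤ x ^ 2 + 3 * y ^ 2 := by positivity
    have l0 : 0 ≤ z ^ 2 + 2 * w ^ 2 := by positivity
    have h1' : 4 * (x ^ 2 + 3 * y ^ 2) + 3 * (z ^ 2 + 2 * w ^ 2) = m := by rw [← h1]; ring
    have i5 : (2 * x) ^ 2 = 4 * x ^ 2 := by ring
    have i6 : (2 * y) ^ 2 = 4 * y ^ 2 := by ring
    rw [i5] at i1
    rw [i6] at i2
    push_cast
    omega
  · rintro ⟨⟨k, l⟩, ⟨x, y⟩, ⟨z, w⟩⟩ h
    simp only [mem_sigma, mem_filter, mem_product, mem_KL, mem_rset (by norm_num : 0 < 3), mem_rset (by norm_num : 0 < 2)] at h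
    obtain ⟨⟨⟨h1, h2⟩, h3⟩, h4, h5⟩ := h
    push_cast at h4 h5
    simp only [T3, mem_filter, mem_NF]
    have i3 := sq8 z
    have i4 := sq8 w
    refine ⟨?_, by omega, by omega⟩
    rw [← h1]; push_cast; rw [← h4, ← h5]; ring
  · rintro ⟨x, y, z, w⟩ h
    simp only [T3, mem_filter, mem_NF] at h
    obtain ⟨h1, h2, h3⟩ := h
    have i1 := sq8 x
    have i2 := sq8 y
    have i3 := sq8 z
    have i4 := sq8 w
    refine Prod.ext ?_ (Prod.ext ?_ rfl) <;> simp only <;> omega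
  · rintro ⟨⟨k, l⟩, ⟨x, y⟩, ⟨z, w⟩⟩ h
    simp only [mem_sigma, mem_filter, mem_product, mem_KL, mem_rset (by norm_num : 0 < 3), mem_rset (by norm_num : 0 < 2)] at h
    obtain ⟨⟨⟨h1, h2⟩, h3⟩, h4, h5⟩ := h
    push_cast at h4 h5
    have e1 : 2 * x / 2 = x := by omega
    have e2 : 2 * y / 2 = y := by omega
    simp only [e1, e2, h4, h5, Int.toNat_natCast]

theorem T1card (m : ℕ) (hm : m % 8 = 5) :
    ((T1 m).card : ℤ) = ∑ p ∈ (KL m).filter (fun p => p.1 % 2 = 1),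
      (((rset 3 (4 * p.1)).filter (fun v => v.1 % 2 = 1)).card : ℤ) * rr 2 p.2 := by
  unfold rr
  simp only [← Nat.cast_mul, ← card_product]
  rw [← Nat.cast_sum, ← card_sigma]
  norm_cast
  refine card_bij' (fun v _ => (⟨((v.1 ^ 2 + 3 * v.2.1 ^ 2).toNat / 4, (v.2.2.1 ^ 2 + 2 * v.2.2.2 ^ 2).toNat),
      ((v.1, v.2.1), (v.2.2.1, v.2.2.2))⟩ : (_ : ℕ × ℕ) × ((ℤ × ℤ) × (ℤ × ℤ))))
    (fun s _ => (s.2.1.1, s.2.1.2, s.2.2.1, s.2.2.2)) ?_ ?_ ?_ ?_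
  · rintro ⟨x, y, z, w⟩ h
    simp only [T1, mem_filter, mem_NF] at h
    obtain ⟨h1, h2, h3, h4, h5⟩ := h
    have i1 := sq8 x
    have i2 := sq8 y
    have i3 := sq8 z
    have i4 := sq8 w
    simp only [mem_sigma, mem_filter, mem_product, mem_KL, mem_rset (by norm_num : 0 < 3), mem_rset (by norm_num : 0 < 2)]
    have k0 : 0 ≤ x ^ 2 + 3 * y ^ 2 := by positivity
    have l0 : 0 ≤ z ^ 2 + 2 * w ^ 2 := by positivity
    push_cast
    omega
  · rintro ⟨⟨k, l⟩, ⟨x, y⟩, ⟨z, w⟩⟩ h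
    simp only [mem_sigma, mem_filter, mem_product, mem_KL, mem_rset (by norm_num : 0 < 3), mem_rset (by norm_num : 0 < 2)] at h
    obtain ⟨⟨⟨h1, h2⟩, h3⟩, ⟨h4, h6⟩, h5⟩ := h
    push_cast at h4 h5
    simp only [T1, mem_filter, mem_NF]
    have i1 := sq8 x
    have i2 := sq8 y
    have i3 := sq8 z
    have i4 := sq8 w
    refine ⟨by omega, by omega, by omega, by omega, by omega⟩
  · rintro ⟨x, y, z, w⟩ h
    rfl
  · rintro ⟨⟨k, l⟩, ⟨x, y⟩, ⟨z, w⟩⟩ h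
    simp only [mem_sigma, mem_filter, mem_product, mem_KL, mem_rset (by norm_num : 0 < 3), mem_rset (by norm_num : 0 < 2)] at h
    obtain ⟨⟨⟨h1, h2⟩, h3⟩, ⟨h4, h6⟩, h5⟩ := h
    push_cast at h4 h5
    have e1 : (4 * (k : ℤ)).toNat / 4 = k := by omega
    simp only [h4, h5, Int.toNat_natCast, e1]

theorem KLfilter (m : ℕ) (hm : m % 8 = 5) :
    ∑ p ∈ (KL m).filter (fun p => p.1 % 2 = 1), dsum chiN p.1 * dsum psiN p.2 =
    ∑ p ∈ KL m, dsum chiN p.1 * dsum psiN p.2 := by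
  refine sum_subset (filter_subset _ _) ?_
  rintro ⟨k, l⟩ h h'
  rw [mem_filter, not_and] at h'
  have h2 := h' h
  rw [mem_KL] at h
  simp only at h2 ⊢
  rw [dsum_psi_zero l (by omega), mul_zero]

theorem T3val (m : ℕ) (hm : m % 8 = 5) :
    ((T3 m).card : ℤ) = 4 * ∑ p ∈ KL m, dsum chiN p.1 * dsum psiN p.2 := by
  rw [T3card m hm, ← KLfilter m hm, mul_sum]
  refine sum_congr rfl ?_
  rintro ⟨k, l⟩ h
  rw [mem_filter, mem_KL] at h
  simp only at h ⊢
  rw [rr3_eq k (by omega), rr2_eq l (by omega)]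
  ring

theorem T1val (m : ℕ) (hm : m % 8 = 5) :
    ((T1 m).card : ℤ) = 8 * ∑ p ∈ KL m, dsum chiN p.1 * dsum psiN p.2 := by
  rw [T1card m hm, ← KLfilter m hm, mul_sum]
  refine sum_congr rfl ?_
  rintro ⟨k, l⟩ h
  rw [mem_filter, mem_KL] at h
  simp only at h ⊢
  rw [ucard k (by omega), rr3_eq4 k (by omega), rr3_eq k (by omega), rr2_eq l (by omega)]
  ring

theorem N_eq (m : ℕ) : N 1 3 3 6 m = (NF m).card := by
  rw [N, ← Set.ncard_coe_finset]
  congr 1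
  ext ⟨x, y, z, w⟩
  rw [Set.mem_setOf_eq, mem_coe, mem_NF]
  push_cast
  rw [one_mul, eq_comm]

theorem t_eq (n : ℕ) : t 1 3 3 6 n = (T1 (8 * n + 13)).card := by
  rw [t, ← Set.ncard_coe_finset]
  have key : ∀ x : ℤ, 2 * (x * (x - 1) / 2) = x * (x - 1) := fun x =>
    Int.mul_ediv_cancel' (by
      have := Int.even_mul_pred_self x
      exact this.two_dvd)
  refine Set.ncard_congr (fun v _ => (2 * v.1 - 1, 2 * v.2.1 - 1, 2 * v.2.2.1 - 1, 2 * v.2.2.2 - 1)) ?_ ?_ ?_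
  · rintro ⟨x, y, z, w⟩ h
    rw [Set.mem_setOf_eq] at h
    simp only [mem_coe, T1, mem_filter, mem_NF]
    simp only at h
    push_cast at h ⊢
    refine ⟨?_, by omega, by omega, by omega, by omega⟩
    linear_combination (-8) * h - 4 * key x - 12 * key y - 12 * key z - 24 * key w
  · rintro ⟨x, y, z, w⟩ ⟨x', y', z', w'⟩ _ _ h
    simp only [Prod.mk.injEq] at h ⊢
    omega
  · rintro ⟨x, y, z, w⟩ h
    simp only [mem_coe, T1, mem_filter, mem_NF] at h
    obtain ⟨h1, h2, h3, h4, h5⟩ := h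
    obtain ⟨x, rfl⟩ : ∃ x', x = 2 * x' - 1 := ⟨(x + 1) / 2, by omega⟩
    obtain ⟨y, rfl⟩ : ∃ x', y = 2 * x' - 1 := ⟨(y + 1) / 2, by omega⟩
    obtain ⟨z, rfl⟩ : ∃ x', z = 2 * x' - 1 := ⟨(z + 1) / 2, by omega⟩
    obtain ⟨w, rfl⟩ : ∃ x', w = 2 * x' - 1 := ⟨(w + 1) / 2, by omega⟩
    refine ⟨(x, y, z, w), ?_, rfl⟩
    rw [Set.mem_setOf_eq]
    push_cast at h1 ⊢
    have : (8 : ℤ) * n = 8 * (1 * (x * (x - 1) / 2) + 3 * (y * (y - 1) / 2) + 3 * (z * (z - 1) / 2) + 6 * (w * (w - 1) / 2)) := by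
      linear_combination (-1) * h1 - 4 * key x - 12 * key y - 12 * key z - 24 * key w
    omega

theorem stmt14 (n β n₁ : ℕ) (hn : 0 < n) (hn₁ : 0 < n₁) (h3 : ¬ (3 ∣ n₁))
    (h : 8 * n + 13 = 3 ^ β * n₁) :
    (t 1 3 3 6 n : ℚ) = 2 / 5 * (N 1 3 3 6 (8 * n + 13) : ℚ) ∧
    (t 1 3 3 6 n : ℚ) = 2 / 3 * ((3 ^ β : ℚ) + (jacobiSym n₁ 3 : ℚ)) *
      ∏ p ∈ n₁.primeFactors,
        ((p : ℚ) ^ (n₁.factorization p + 1) - (jacobiSym 6 p : ℚ) ^ (n₁.factorization p + 1)) /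
          ((p : ℚ) - (jacobiSym 6 p : ℚ)) := by
  have hm : (8 * n + 13) % 8 = 5 := by omega
  have hodd : n₁ % 2 = 1 := by
    by_contra hc
    have : 2 ∣ 3 ^ β * n₁ := Dvd.dvd.mul_left (by omega) _
    omega
  have a1 := T1val _ hm
  have a3 := T3val _ hm
  have a12 := T12 _ hm
  have a34 := T34 (8 * n + 13)
  have aN := NF_card _ hm
  rw [N_eq, t_eq]
  constructor
  · have : 5 * (T1 (8 * n + 13)).card = 2 * (NF (8 * n + 13)).card := by omega
    have : (5 : ℚ) * (T1 (8 * n + 13)).card = 2 * (NF (8 * n + 13)).card := by exact_mod_cast this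
    linarith
  · have p3 := Part3 _ β n₁ hm h3 h
    rw [Qsum _ hm, P4a _ β n₁ h3 h] at p3
    rw [← P4b n₁ hn₁.ne' hodd, jac3]
    have : (3 : ℤ) * (T1 (8 * n + 13)).card = 2 * ((3 ^ β + chi n₁) * ∑ d ∈ n₁.divisorsAntidiagonal, (d.1 : ℤ) * c24 d.2) := by
      rw [← p3]; linarith
    have : (3 : ℚ) * (T1 (8 * n + 13)).card = 2 * ((3 ^ β + chi n₁) * ((∑ d ∈ n₁.divisorsAntidiagonal, (d.1 : ℤ) * c24 d.2 : ℤ) : ℚ)) := by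
      exact_mod_cast this
    linarith
end

section
/- For every positive integer n with n ≡ 1 or 2 (mod 4), t(1,1,4,6;n) = 2·N(1,1,4,6; 2n+3). -/
theorem half_aux {α : Type*} (T : Set α) (P : α → Prop) (σ : α → α)
    (hσ : ∀ x, σ (σ x) = x) (hT : ∀ x ∈ T, σ x ∈ T)
    (hP : ∀ x ∈ T, (P (σ x) ↔ ¬ P x)) :
    T.ncard = 2 * {x | x ∈ T ∧ P x}.ncard := by
  have hinj : Function.Injective σ := fun a b h => by rw [← hσ a, ← hσ b, h]
  have hU : T = {x | x ∈ T ∧ P x} ∪ σ '' {x | x ∈ T ∧ P x} := by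
    ext x
    constructor
    · intro hx
      by_cases h : P x
      · exact Or.inl ⟨hx, h⟩
      · exact Or.inr ⟨σ x, ⟨hT x hx, (hP x hx).2 h⟩, hσ x⟩
    · rintro (h | ⟨y, hy, rfl⟩)
      · exact h.1
      · exact hT y hy.1
  by_cases hf : {x | x ∈ T ∧ P x}.Finite
  · have hd : Disjoint {x | x ∈ T ∧ P x} (σ '' {x | x ∈ T ∧ P x}) := by
      rw [Set.disjoint_left]
      rintro x hx ⟨y, hy, rfl⟩
      exact (hP y hy.1).1 hx.2 hy.2
    have := Set.ncard_union_eq hd hf (hf.image σ)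
    rw [← hU, Set.ncard_image_of_injective _ hinj] at this
    omega
  · have hi : T.Infinite := fun h => hf (h.subset fun x hx => hx.1)
    rw [Set.Infinite.ncard hi, Set.Infinite.ncard hf]

theorem two_tri (x : ℤ) : 2 * (x * (x - 1) / 2) = x * (x - 1) := by
  apply Int.mul_ediv_cancel'
  rcases Int.even_or_odd' x with ⟨k, rfl | rfl⟩
  · exact ⟨k * (2 * k - 1), by ring⟩
  · exact ⟨k * (2 * k + 1), by ring⟩

theorem tri_iff (n x y z w : ℤ) :
    (n = ((1 : ℕ) : ℤ) * (x * (x - 1) / 2) + ((1 : ℕ) : ℤ) * (y * (y - 1) / 2)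
      + ((4 : ℕ) : ℤ) * (z * (z - 1) / 2) + ((6 : ℕ) : ℤ) * (w * (w - 1) / 2)) ↔
    2 * n = x * (x - 1) + y * (y - 1) + 4 * (z * (z - 1)) + 6 * (w * (w - 1)) := by
  have h1 := two_tri x
  have h2 := two_tri y
  have h3 := two_tri z
  have h4 := two_tri w
  push_cast
  constructor <;> intro h <;> linarith

theorem sq_mod4 (q : ℤ) : (q % 2 = 0 ∧ (q ^ 2) % 4 = 0) ∨ (q % 2 = 1 ∧ (q ^ 2) % 4 = 1) := by
  rcases Int.even_or_odd' q with ⟨k, rfl | rfl⟩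
  · left
    have : (2 * k) ^ 2 = 4 * k ^ 2 := by ring
    omega
  · right
    have : (2 * k + 1) ^ 2 = 4 * (k ^ 2 + k) + 1 := by ring
    omega

theorem bij_aux (n : ℕ) (hmod : n % 4 = 1 ∨ n % 4 = 2) :
    {P : ℤ × ℤ × ℤ × ℤ | 2 * (n : ℤ) = P.1 * (P.1 - 1) + P.2.1 * (P.2.1 - 1)
        + 4 * (P.2.2.1 * (P.2.2.1 - 1)) + 6 * (P.2.2.2 * (P.2.2.2 - 1))
        ∧ (P.1 + P.2.1 - 2 * P.2.2.2) % 4 = 0}.ncard =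
    {P : ℤ × ℤ × ℤ × ℤ | 2 * (n : ℤ) + 3 = P.1 ^ 2 + P.2.1 ^ 2
        + 4 * P.2.2.1 ^ 2 + 6 * P.2.2.2 ^ 2 ∧ P.1 % 2 = 1}.ncard := by
  have key1 : ∀ x y z w : ℤ, 2 * (n : ℤ) = x * (x - 1) + y * (y - 1)
        + 4 * (z * (z - 1)) + 6 * (w * (w - 1)) → (x + y - 2 * w) % 4 = 0 →
      ∃ b q Z, x = w + 2 * b + q ∧ y = w + 2 * b - q ∧ b + 2 * w - 1 - q = 2 * Z := by
    intro x y z w h h0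
    obtain ⟨b, hb⟩ : ∃ b, x + y - 2 * w = 4 * b := ⟨(x + y - 2 * w) / 4, by omega⟩
    obtain ⟨q, hq⟩ : ∃ q, x - y = 2 * q := ⟨(x - y) / 2, by omega⟩
    have hx : x = w + 2 * b + q := by omega
    have hy : y = w + 2 * b - q := by omega
    subst hx hy
    have e : (n : ℤ) = 4 * (w ^ 2 + w * b + b ^ 2 - w) + q ^ 2 - 2 * b
        + 4 * (z * (z - 1) / 2) := by
      have := two_tri z
      linarith
    refine ⟨b, q, (b + 2 * w - 1 - q) / 2, rfl, rfl, ?_⟩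
    rcases sq_mod4 q with h | h <;> omega
  have key2 : ∀ x y z w : ℤ, 2 * (n : ℤ) + 3 = x ^ 2 + y ^ 2 + 4 * z ^ 2 + 6 * w ^ 2 →
      x % 2 = 1 → ∃ k c d, y = 2 * k ∧ x = 2 * d - 1 ∧ k + z - w = 2 * c - 1 := by
    intro x y z w h h0
    obtain ⟨d, rfl⟩ : ∃ d, x = 2 * d - 1 := ⟨(x + 1) / 2, by omega⟩
    obtain ⟨k, rfl⟩ : ∃ k, y = 2 * k := by
      refine ⟨y / 2, ?_⟩
      have : y ^ 2 = 2 * (n + 1 - 2 * d ^ 2 + 2 * d - 2 * z ^ 2 - 3 * w ^ 2) := by linarith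
      rcases sq_mod4 y with h | h <;> omega
    have e : (n : ℤ) + 1 = 4 * (d * (d - 1) / 2) + 2 * k ^ 2 + 2 * z ^ 2 + 3 * w ^ 2 := by
      have := two_tri d
      linarith
    refine ⟨k, (k + z - w + 1) / 2, d, rfl, rfl, ?_⟩
    rcases sq_mod4 k with h1 | h1 <;> rcases sq_mod4 z with h2 | h2 <;>
      rcases sq_mod4 w with h3 | h3 <;> omega
  let f : ℤ × ℤ × ℤ × ℤ → ℤ × ℤ × ℤ × ℤ := fun P =>
    let b := (P.1 + P.2.1 - 2 * P.2.2.2) / 4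
    let q := (P.1 - P.2.1) / 2
    let p := b + 2 * P.2.2.2 - 1
    (2 * P.2.2.1 - 1, p + q, (p - q) / 2, b)
  let g : ℤ × ℤ × ℤ × ℤ → ℤ × ℤ × ℤ × ℤ := fun P =>
    let p := P.2.1 / 2 + P.2.2.1
    let q := P.2.1 / 2 - P.2.2.1
    let w := (p - P.2.2.2 + 1) / 2
    (w + 2 * P.2.2.2 + q, w + 2 * P.2.2.2 - q, (P.1 + 1) / 2, w)
  have hf : ∀ w b q Z z : ℤ, b + 2 * w - 1 - q = 2 * Z →
      f (w + 2 * b + q, w + 2 * b - q, z, w) = (2 * z - 1, 2 * Z + 2 * q, Z, b) := by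
    intro w b q Z z h
    simp only [f, Prod.mk.injEq]
    refine ⟨trivial, ?_, ?_, ?_⟩ <;> omega
  have hg : ∀ k c d z w : ℤ, k + z - w = 2 * c - 1 →
      g (2 * d - 1, 2 * k, z, w) = (c + 2 * w + (k - z), c + 2 * w - (k - z), d, c) := by
    intro k c d z w h
    simp only [g, Prod.mk.injEq]
    refine ⟨?_, ?_, ?_, ?_⟩ <;> omega
  refine Set.BijOn.ncard_eq (f := f) (Set.InvOn.bijOn (f' := g) ⟨?_, ?_⟩ ?_ ?_)
  · rintro ⟨x, y, z, w⟩ ⟨h, h0⟩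
    obtain ⟨b, q, Z, rfl, rfl, hZ⟩ := key1 x y z w h h0
    rw [hf w b q Z z hZ, show 2 * Z + 2 * q = 2 * (Z + q) by ring,
      hg (Z + q) w z Z b (by linarith)]
    simp only [Prod.mk.injEq, and_true]
    constructor <;> ring
  · rintro ⟨x, y, z, w⟩ ⟨h, h0⟩
    obtain ⟨k, c, d, rfl, rfl, hc⟩ := key2 x y z w h h0
    rw [hg k c d z w hc, hf c w (k - z) z d (by linarith)]
    simp only [Prod.mk.injEq, and_true, true_and]
    ring
  · rintro ⟨x, y, z, w⟩ ⟨h, h0⟩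
    obtain ⟨b, q, Z, rfl, rfl, hZ⟩ := key1 x y z w h h0
    rw [hf w b q Z z hZ]
    refine ⟨?_, by dsimp only; omega⟩
    dsimp only at h ⊢
    obtain rfl : q = b + 2 * w - 1 - 2 * Z := by linarith
    linear_combination h
  · rintro ⟨x, y, z, w⟩ ⟨h, h0⟩
    obtain ⟨k, c, d, rfl, rfl, hc⟩ := key2 x y z w h h0
    rw [hg k c d z w hc]
    refine ⟨?_, by dsimp only; omega⟩
    dsimp only at h ⊢
    obtain rfl : w = k + z - 2 * c + 1 := by linarith
    linear_combination h

theorem stmt15 (n : ℕ) (hn : 0 < n) (hmod : n % 4 = 1 ∨ n % 4 = 2) :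
    t 1 1 4 6 n = 2 * N 1 1 4 6 (2 * n + 3) := by
  unfold t N
  simp only [tri_iff]
  rw [half_aux _ (fun P => (P.1 + P.2.1) % 2 = 0) (fun P => (P.1, 1 - P.2.1, P.2.2.1, P.2.2.2))
    (by rintro ⟨x, y, z, w⟩; simp) (by
      rintro ⟨x, y, z, w⟩ h
      simp only [Set.mem_setOf_eq] at h ⊢
      linear_combination h) (by
      rintro ⟨x, y, z, w⟩ h
      dsimp only
      omega)]
  rw [half_aux _ (fun P => (P.1 + P.2.1 - 2 * P.2.2.2) % 4 = 0)
    (fun P => (P.1, P.2.1, P.2.2.1, 1 - P.2.2.2))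
    (by rintro ⟨x, y, z, w⟩; simp) (by
      rintro ⟨x, y, z, w⟩ h
      simp only [Set.mem_setOf_eq] at h ⊢
      refine ⟨?_, h.2⟩
      linear_combination h.1) (by
      rintro ⟨x, y, z, w⟩ ⟨h, h0⟩
      dsimp only at h0 ⊢
      omega)]
  rw [half_aux {P : ℤ × ℤ × ℤ × ℤ | ((2 * n + 3 : ℕ) : ℤ) = _}
    (fun P => P.1 % 2 = 1) (fun P => (P.2.1, P.1, P.2.2.1, P.2.2.2))
    (by rintro ⟨x, y, z, w⟩; simp) (by
      rintro ⟨x, y, z, w⟩ h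
      simp only [Set.mem_setOf_eq] at h ⊢
      push_cast at h ⊢
      linear_combination h) (by
      rintro ⟨x, y, z, w⟩ h
      simp only [Set.mem_setOf_eq] at h ⊢
      push_cast at h
      rcases sq_mod4 x with h1 | h1 <;> rcases sq_mod4 y with h2 | h2 <;> omega)]
  have := bij_aux n hmod
  congr 2
  convert this using 2
  · ext ⟨x, y, z, w⟩
    simp only [Set.mem_setOf_eq]
    constructor
    · rintro ⟨⟨h, h1⟩, h2⟩
      exact ⟨h, h2⟩
    · rintro ⟨h, h2⟩
      exact ⟨⟨h, by omega⟩, h2⟩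
  · ext ⟨x, y, z, w⟩
    simp only [Set.mem_setOf_eq]
    push_cast
    simp only [one_mul]
end

section
/- For every positive integer n with n ≡ 1 (mod 4), t(2,2,3,9;n) = (4/3)·N(2,2,3,9; 2n+4). -/
abbrev Q4 := ℤ × ℤ × ℤ × ℤ

lemma ncard_of_map (S T : Set Q4) (f : Q4 → Q4) (hm : ∀ x ∈ S, f x ∈ T)
    (hi : ∀ x ∈ S, ∀ y ∈ S, f x = f y → x = y) (hs : ∀ y ∈ T, ∃ x ∈ S, f x = y) :
    S.ncard = T.ncard :=
  Set.ncard_congr (fun a _ => f a) hm (fun a b ha hb h => hi a ha b hb h)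
    (fun b hb => by obtain ⟨x, hx, h⟩ := hs b hb; exact ⟨x, hx, h⟩)

lemma ncard_part (S : Set Q4) (hS : S.Finite) (p : Q4 → Prop) :
    S.ncard = {x | x ∈ S ∧ p x}.ncard + {x | x ∈ S ∧ ¬ p x}.ncard := by
  rw [← Set.ncard_union_eq ?_ (hS.subset fun x hx => hx.1) (hS.subset fun x hx => hx.1)]
  · congr 1; ext x; simp only [Set.mem_union, Set.mem_ofPred_eq]; tauto
  · rw [Set.disjoint_left]; rintro x ⟨_, h⟩ ⟨_, h'⟩; exact h' h

lemma ncard_half (S : Set Q4) (hS : S.Finite) (p : Q4 → Prop) (s : Q4 → Q4)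
    (hss : ∀ x, s (s x) = x) (hm : ∀ x ∈ S, s x ∈ S) (hp : ∀ x ∈ S, (p (s x) ↔ ¬ p x)) :
    S.ncard = 2 * {x | x ∈ S ∧ p x}.ncard := by
  rw [ncard_part S hS p, two_mul]
  congr 1
  symm
  refine ncard_of_map _ _ s ?_ ?_ ?_
  · rintro x ⟨h, h'⟩
    exact ⟨hm x h, by rw [hp x h]; simpa using h'⟩
  · intro x _ y _ h
    rw [← hss x, h, hss]
  · rintro y ⟨h, h'⟩
    exact ⟨s y, ⟨hm y h, by rw [hp y h]; exact h'⟩, hss y⟩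

lemma fin_form (k a b c d : ℤ) (ha : 0 < a) (hb : 0 < b) (hc : 0 < c) (hd : 0 < d) :
    {P : Q4 | k = a * P.1 ^ 2 + b * P.2.1 ^ 2 + c * P.2.2.1 ^ 2 + d * P.2.2.2 ^ 2}.Finite := by
  have key : ∀ x a : ℤ, 0 < a → |x| ≤ a * x ^ 2 := by
    intro x a h
    have h1 : |x| ≤ x ^ 2 := by
      rw [← sq_abs]
      rcases (abs_nonneg x).eq_or_lt with h0 | h0
      · rw [← h0]; norm_num
      · nlinarith
    nlinarith [sq_nonneg x]
  refine ((Set.finite_Icc (-k) k).prod ((Set.finite_Icc (-k) k).prod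
    ((Set.finite_Icc (-k) k).prod (Set.finite_Icc (-k) k)))).subset ?_
  rintro ⟨x, y, z, w⟩ h
  simp only [Set.mem_ofPred_eq] at h
  have h1 := key x a ha
  have h2 := key y b hb
  have h3 := key z c hc
  have h4 := key w d hd
  have p1 := abs_nonneg x
  have p2 := abs_nonneg y
  have p3 := abs_nonneg z
  have p4 := abs_nonneg w
  simp only [Set.mem_prod, Set.mem_Icc, ← abs_le]
  refine ⟨?_, ?_, ?_, ?_⟩ <;> linarith

lemma sqc (x : ℤ) : (x % 2 = 1 ∧ x ^ 2 % 8 = 1) ∨ (x % 4 = 0 ∧ x ^ 2 % 16 = 0) ∨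
    (x % 4 = 2 ∧ x ^ 2 % 16 = 4) := by
  have h8 : x % 8 = 0 ∨ x % 8 = 1 ∨ x % 8 = 2 ∨ x % 8 = 3 ∨ x % 8 = 4 ∨ x % 8 = 5 ∨ x % 8 = 6
    ∨ x % 8 = 7 := by omega
  have e : x ^ 2 = 16 * (4 * (x / 8) ^ 2 + (x / 8) * (x % 8)) + (x % 8) ^ 2 := by
    conv_lhs => rw [← Int.mul_ediv_add_emod x 8]
    ring
  rcases h8 with h | h | h | h | h | h | h | h <;> rw [h] at e <;> omega

/-- all odd, `2X²+2Y²+3Z²+9W² = 8M` -/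
def SA (M : ℤ) : Set Q4 := {P | 8 * M = 2 * P.1 ^ 2 + 2 * P.2.1 ^ 2 + 3 * P.2.2.1 ^ 2
  + 9 * P.2.2.2 ^ 2 ∧ P.1 % 2 = 1 ∧ P.2.1 % 2 = 1 ∧ P.2.2.1 % 2 = 1 ∧ P.2.2.2 % 2 = 1}
def SF (M : ℤ) : Set Q4 := {P | 2 * M = 1 * P.1 ^ 2 + 1 * P.2.1 ^ 2 + 3 * P.2.2.1 ^ 2
  + 9 * P.2.2.2 ^ 2 ∧ (P.1 + P.2.1) % 2 = 1}
def SH (M : ℤ) : Set Q4 := {P | 2 * M = 1 * P.1 ^ 2 + 4 * P.2.1 ^ 2 + 12 * P.2.2.1 ^ 2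
  + 9 * P.2.2.2 ^ 2}
def SG (M : ℤ) : Set Q4 := {P | 2 * M = 1 * P.1 ^ 2 + 1 * P.2.1 ^ 2 + 3 * P.2.2.1 ^ 2
  + 9 * P.2.2.2 ^ 2 ∧ P.1 % 2 = 1 ∧ P.2.1 % 2 = 1 ∧ P.2.2.1 % 2 = 1 ∧ P.2.2.2 % 2 = 1}
def SE (M : ℤ) : Set Q4 := {P | M = P.1 ^ 2 + P.2.1 ^ 2 + 6 * P.2.2.1 ^ 2 + 18 * P.2.2.2 ^ 2}
def SN (M : ℤ) : Set Q4 := {P | 2 * M = 2 * P.1 ^ 2 + 2 * P.2.1 ^ 2 + 3 * P.2.2.1 ^ 2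
  + 9 * P.2.2.2 ^ 2}

lemma SE_par {M x y z w : ℤ} (hM : M % 4 = 3) (h : M = x ^ 2 + y ^ 2 + 6 * z ^ 2 + 18 * w ^ 2) :
    (x + y) % 2 = 1 ∧ (z + w) % 2 = 1 := by
  have := sqc x
  have := sqc y
  have := sqc z
  have := sqc w
  omega

lemma SH_par {M x y z w : ℤ} (hM : M % 4 = 3)
    (h : 2 * M = 1 * x ^ 2 + 4 * y ^ 2 + 12 * z ^ 2 + 9 * w ^ 2) :
    x % 2 = 1 ∧ w % 2 = 1 ∧ (y + z) % 2 = 1 := by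
  have := sqc x
  have := sqc y
  have := sqc z
  have := sqc w
  omega

lemma SF_par {M x y z w : ℤ} (hM : M % 4 = 3)
    (h : 2 * M = 1 * x ^ 2 + 1 * y ^ 2 + 3 * z ^ 2 + 9 * w ^ 2) (hx : x % 2 = 1)
    (hxy : (x + y) % 2 = 1) : y % 2 = 0 ∧ z % 2 = 0 := by
  have := sqc x
  have := sqc y
  have := sqc z
  have := sqc w
  omega

lemma SN_par {M x y z w : ℤ}
    (h : 2 * M = 2 * x ^ 2 + 2 * y ^ 2 + 3 * z ^ 2 + 9 * w ^ 2) : (z + w) % 2 = 0 := by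
  have := sqc z
  have := sqc w
  omega

lemma cA (M : ℤ) : (SA M).ncard = 2 * {P | P ∈ SA M ∧ (P.2.2.1 - P.2.2.2) % 4 = 0}.ncard := by
  refine ncard_half _ ((fin_form (8 * M) 2 2 3 9 (by norm_num) (by norm_num) (by norm_num)
    (by norm_num)).subset fun x h => h.1) _ (fun P => (P.1, P.2.1, P.2.2.1, -P.2.2.2)) ?_ ?_ ?_
  · rintro ⟨x, y, z, w⟩; simp
  · rintro ⟨x, y, z, w⟩ ⟨h, h1, h2, h3, h4⟩
    dsimp only at *
    exact ⟨by dsimp only; linear_combination h, h1, h2, h3, by dsimp only; omega⟩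
  · rintro ⟨x, y, z, w⟩ ⟨h, h1, h2, h3, h4⟩
    dsimp only at *
    omega

lemma cG1 (M : ℤ) : (SG M).ncard = 2 * {P | P ∈ SG M ∧ (P.2.2.1 - P.2.2.2) % 4 = 0}.ncard := by
  refine ncard_half _ ((fin_form (2 * M) 1 1 3 9 (by norm_num) (by norm_num) (by norm_num)
    (by norm_num)).subset fun x h => h.1) _ (fun P => (P.1, P.2.1, P.2.2.1, -P.2.2.2)) ?_ ?_ ?_
  · rintro ⟨x, y, z, w⟩; simp
  · rintro ⟨x, y, z, w⟩ ⟨h, h1, h2, h3, h4⟩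
    dsimp only at *
    exact ⟨by dsimp only; linear_combination h, h1, h2, h3, by dsimp only; omega⟩
  · rintro ⟨x, y, z, w⟩ ⟨h, h1, h2, h3, h4⟩
    dsimp only at *
    omega

lemma cG2 (M : ℤ) : (SG M).ncard = 2 * {P | P ∈ SG M ∧ (P.2.1 - P.2.2.1) % 4 = 0}.ncard := by
  refine ncard_half _ ((fin_form (2 * M) 1 1 3 9 (by norm_num) (by norm_num) (by norm_num)
    (by norm_num)).subset fun x h => h.1) _ (fun P => (P.1, P.2.1, -P.2.2.1, P.2.2.2)) ?_ ?_ ?_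
  · rintro ⟨x, y, z, w⟩; simp
  · rintro ⟨x, y, z, w⟩ ⟨h, h1, h2, h3, h4⟩
    dsimp only at *
    exact ⟨by dsimp only; linear_combination h, h1, h2, by dsimp only; omega, h4⟩
  · rintro ⟨x, y, z, w⟩ ⟨h, h1, h2, h3, h4⟩
    dsimp only at *
    omega

lemma cF (M : ℤ) : (SF M).ncard = 2 * {P | P ∈ SF M ∧ P.1 % 2 = 1}.ncard := by
  refine ncard_half _ ((fin_form (2 * M) 1 1 3 9 (by norm_num) (by norm_num) (by norm_num)
    (by norm_num)).subset fun x h => h.1) _ (fun P => (P.2.1, P.1, P.2.2.1, P.2.2.2)) ?_ ?_ ?_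
  · rintro ⟨x, y, z, w⟩; simp
  · rintro ⟨x, y, z, w⟩ ⟨h, h1⟩
    dsimp only at *
    exact ⟨by dsimp only; linear_combination h, by dsimp only; omega⟩
  · rintro ⟨x, y, z, w⟩ ⟨h, h1⟩
    dsimp only at *
    omega

lemma cFA (M : ℤ) (hM : M % 4 = 3) :
    (SF M).ncard = {P | P ∈ SA M ∧ (P.2.2.1 - P.2.2.2) % 4 = 0}.ncard := by
  refine ncard_of_map _ _ (fun P => (P.1 + P.2.1, P.1 - P.2.1, P.2.2.1 + 3 * P.2.2.2,
    P.2.2.1 - P.2.2.2)) ?_ ?_ ?_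
  · rintro ⟨x, y, z, w⟩ ⟨h, h1⟩
    dsimp only at *
    have : (z + w) % 2 = 1 := by
      have := sqc x
      have := sqc y
      have := sqc z
      have := sqc w
      omega
    refine ⟨⟨?_, ?_, ?_, ?_, ?_⟩, ?_⟩ <;> dsimp only
    · linear_combination 4 * h
    all_goals omega
  · rintro ⟨x, y, z, w⟩ _ ⟨x', y', z', w'⟩ _ h
    simp only [Prod.mk.injEq] at *
    omega
  · rintro ⟨x, y, z, w⟩ ⟨⟨h, h1, h2, h3, h4⟩, h5⟩
    dsimp only at *
    obtain ⟨a, rfl⟩ : ∃ a, x = 2 * a - y := ⟨(x + y) / 2, by omega⟩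
    obtain ⟨d, rfl⟩ : ∃ d, z = w + 4 * d := ⟨(z - w) / 4, by omega⟩
    refine ⟨(a, a - y, w + d, d), ⟨?_, ?_⟩, ?_⟩
    · dsimp only; linarith
    · dsimp only; omega
    · simp only [Prod.mk.injEq, true_and, and_true]; omega

lemma cHF (M : ℤ) (hM : M % 4 = 3) :
    (SH M).ncard = {P | P ∈ SF M ∧ P.1 % 2 = 1}.ncard := by
  refine ncard_of_map _ _ (fun P => (P.1, 2 * P.2.1, 2 * P.2.2.1, P.2.2.2)) ?_ ?_ ?_
  · rintro ⟨x, y, z, w⟩ h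
    have := SH_par hM h
    dsimp only at this
    simp only [SH, Set.mem_ofPred_eq] at h
    refine ⟨⟨?_, ?_⟩, ?_⟩ <;> dsimp only
    · linear_combination h
    all_goals omega
  · rintro ⟨x, y, z, w⟩ _ ⟨x', y', z', w'⟩ _ h
    simp only [Prod.mk.injEq] at *
    omega
  · rintro ⟨x, y, z, w⟩ ⟨⟨h, h1⟩, h5⟩
    dsimp only at *
    have := SF_par hM h h5 h1
    obtain ⟨b, rfl⟩ : ∃ b, y = 2 * b := ⟨y / 2, by omega⟩
    obtain ⟨c, rfl⟩ : ∃ c, z = 2 * c := ⟨z / 2, by omega⟩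
    refine ⟨(x, b, c, w), ?_, rfl⟩
    simp only [SH, Set.mem_ofPred_eq]
    linarith

lemma cHG (M : ℤ) (hM : M % 4 = 3) :
    (SH M).ncard = {P | P ∈ SG M ∧ (P.2.1 - P.2.2.1) % 4 = 0}.ncard := by
  refine ncard_of_map _ _ (fun P => (P.1, P.2.1 + 3 * P.2.2.1, P.2.1 - P.2.2.1, P.2.2.2)) ?_ ?_ ?_
  · rintro ⟨x, y, z, w⟩ h
    have := SH_par hM h
    dsimp only at this
    simp only [SH, Set.mem_ofPred_eq] at h
    refine ⟨⟨?_, ?_, ?_, ?_, ?_⟩, ?_⟩ <;> dsimp only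
    · linear_combination h
    all_goals omega
  · rintro ⟨x, y, z, w⟩ _ ⟨x', y', z', w'⟩ _ h
    simp only [Prod.mk.injEq] at *
    omega
  · rintro ⟨x, y, z, w⟩ ⟨⟨h, h1, h2, h3, h4⟩, h5⟩
    dsimp only at *
    obtain ⟨d, rfl⟩ : ∃ d, y = z + 4 * d := ⟨(y - z) / 4, by omega⟩
    refine ⟨(x, z + d, d, w), ?_, ?_⟩
    · simp only [SH, Set.mem_ofPred_eq]
      linarith
    · simp only [Prod.mk.injEq, true_and, and_true]; omega

lemma cEG (M : ℤ) (hM : M % 4 = 3) :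
    (SE M).ncard = {P | P ∈ SG M ∧ (P.2.2.1 - P.2.2.2) % 4 = 0}.ncard := by
  refine ncard_of_map _ _ (fun P => (P.1 + P.2.1, P.1 - P.2.1, P.2.2.1 + 3 * P.2.2.2,
    P.2.2.1 - P.2.2.2)) ?_ ?_ ?_
  · rintro ⟨x, y, z, w⟩ h
    have := SE_par hM h
    dsimp only at this
    simp only [SE, Set.mem_ofPred_eq] at h
    refine ⟨⟨?_, ?_, ?_, ?_, ?_⟩, ?_⟩ <;> dsimp only
    · linear_combination 2 * h
    all_goals omega
  · rintro ⟨x, y, z, w⟩ _ ⟨x', y', z', w'⟩ _ h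
    simp only [Prod.mk.injEq] at *
    omega
  · rintro ⟨x, y, z, w⟩ ⟨⟨h, h1, h2, h3, h4⟩, h5⟩
    dsimp only at *
    obtain ⟨a, rfl⟩ : ∃ a, x = 2 * a - y := ⟨(x + y) / 2, by omega⟩
    obtain ⟨d, rfl⟩ : ∃ d, z = w + 4 * d := ⟨(z - w) / 4, by omega⟩
    refine ⟨(a, a - y, w + d, d), ?_, ?_⟩
    · simp only [SE, Set.mem_ofPred_eq]; linarith
    · simp only [Prod.mk.injEq, true_and, and_true]; omega

lemma cN (M : ℤ) (hM : M % 4 = 3) : (SN M).ncard = 3 * (SE M).ncard := by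
  have hf : (SN M).Finite := fin_form (2 * M) 2 2 3 9 (by norm_num) (by norm_num) (by norm_num)
    (by norm_num)
  have h1 : (SE M).ncard = {P | P ∈ SN M ∧ P.2.2.1 % 2 = 0}.ncard := by
    refine ncard_of_map _ _ (fun P => (P.1, P.2.1, 2 * P.2.2.1, 2 * P.2.2.2)) ?_ ?_ ?_
    · rintro ⟨x, y, z, w⟩ h
      simp only [SE, Set.mem_ofPred_eq] at h
      refine ⟨?_, ?_⟩
      · simp only [SN, Set.mem_ofPred_eq]; linear_combination 2 * h
      · dsimp only; omega
    · rintro ⟨x, y, z, w⟩ _ ⟨x', y', z', w'⟩ _ h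
      simp only [Prod.mk.injEq] at *
      omega
    · rintro ⟨x, y, z, w⟩ ⟨h, h5⟩
      have := SN_par h
      dsimp only at this
      simp only [SN, Set.mem_ofPred_eq] at h
      dsimp only at h5
      obtain ⟨b, rfl⟩ : ∃ b, z = 2 * b := ⟨z / 2, by omega⟩
      obtain ⟨c, rfl⟩ : ∃ c, w = 2 * c := ⟨w / 2, by omega⟩
      refine ⟨(x, y, b, c), ?_, rfl⟩
      simp only [SE, Set.mem_ofPred_eq]
      linarith
  have h2 : {P | P ∈ SN M ∧ ¬ P.2.2.1 % 2 = 0}.ncard =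
      2 * {P | P ∈ {P | P ∈ SN M ∧ ¬ P.2.2.1 % 2 = 0} ∧ (P.2.2.1 - P.2.2.2) % 4 = 0}.ncard := by
    refine ncard_half _ (hf.subset fun x h => h.1) _
      (fun P => (P.1, P.2.1, P.2.2.1, -P.2.2.2)) ?_ ?_ ?_
    · rintro ⟨x, y, z, w⟩; simp
    · rintro ⟨x, y, z, w⟩ ⟨h, h1⟩
      refine ⟨?_, h1⟩
      simp only [SN, Set.mem_ofPred_eq] at h ⊢
      linear_combination h
    · rintro ⟨x, y, z, w⟩ ⟨h, h1⟩
      have := SN_par h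
      dsimp only at this
      dsimp only at *
      omega
  have h3 : (SE M).ncard =
      {P | P ∈ {P | P ∈ SN M ∧ ¬ P.2.2.1 % 2 = 0} ∧ (P.2.2.1 - P.2.2.2) % 4 = 0}.ncard := by
    refine ncard_of_map _ _ (fun P => (P.1, P.2.1, P.2.2.1 + 3 * P.2.2.2,
      P.2.2.1 - P.2.2.2)) ?_ ?_ ?_
    · rintro ⟨x, y, z, w⟩ h
      have := SE_par hM h
      dsimp only at this
      simp only [SE, SN, Set.mem_ofPred_eq] at *
      refine ⟨⟨?_, ?_⟩, ?_⟩
      · linear_combination 2 * h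
      all_goals omega
    · rintro ⟨x, y, z, w⟩ _ ⟨x', y', z', w'⟩ _ h
      simp only [Prod.mk.injEq] at *
      omega
    · rintro ⟨x, y, z, w⟩ ⟨⟨h, h1⟩, h5⟩
      simp only [SN, Set.mem_ofPred_eq] at h h1 h5
      obtain ⟨d, rfl⟩ : ∃ d, z = w + 4 * d := ⟨(z - w) / 4, by omega⟩
      refine ⟨(x, y, w + d, d), ?_, ?_⟩
      · simp only [SE, Set.mem_ofPred_eq]; linarith
      · simp only [Prod.mk.injEq, true_and, and_true]; omega
  rw [ncard_part (SN M) hf (fun P => P.2.2.1 % 2 = 0), h2, ← h1, ← h3]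
  ring

lemma tri (x : ℤ) : 2 * (x * (x - 1) / 2) = x ^ 2 - x := by
  have h : x ^ 2 - x = x * (x - 1) := by ring
  rw [h]
  exact Int.mul_ediv_cancel' (Int.even_mul_pred_self x).two_dvd

lemma cT (n : ℕ) : t 2 2 3 9 n = (SA ((n : ℤ) + 2)).ncard := by
  refine ncard_of_map _ _ (fun P => (2 * P.1 - 1, 2 * P.2.1 - 1, 2 * P.2.2.1 - 1,
    2 * P.2.2.2 - 1)) ?_ ?_ ?_
  · rintro ⟨x, y, z, w⟩ h
    simp only [Set.mem_ofPred_eq] at h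
    push_cast at h
    refine ⟨?_, ?_, ?_, ?_, ?_⟩ <;> dsimp only
    · linear_combination 8 * h + 8 * tri x + 8 * tri y + 12 * tri z + 36 * tri w
    all_goals omega
  · rintro ⟨x, y, z, w⟩ _ ⟨x', y', z', w'⟩ _ h
    simp only [Prod.mk.injEq] at *
    omega
  · rintro ⟨x, y, z, w⟩ ⟨h, h1, h2, h3, h4⟩
    dsimp only at *
    obtain ⟨a, rfl⟩ : ∃ a, x = 2 * a - 1 := ⟨(x + 1) / 2, by omega⟩
    obtain ⟨b, rfl⟩ : ∃ a, y = 2 * a - 1 := ⟨(y + 1) / 2, by omega⟩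
    obtain ⟨c, rfl⟩ : ∃ a, z = 2 * a - 1 := ⟨(z + 1) / 2, by omega⟩
    obtain ⟨d, rfl⟩ : ∃ a, w = 2 * a - 1 := ⟨(w + 1) / 2, by omega⟩
    refine ⟨(a, b, c, d), ?_, rfl⟩
    simp only [Set.mem_ofPred_eq]
    push_cast
    linarith [tri a, tri b, tri c, tri d]

theorem stmt16 (n : ℕ) (hn : 0 < n) (hmod : n % 4 = 1) :
    (t 2 2 3 9 n : ℚ) = 4 / 3 * (N 2 2 3 9 (2 * n + 4) : ℚ) := by
  have hM : ((n : ℤ) + 2) % 4 = 3 := by omega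
  have hN : N 2 2 3 9 (2 * n + 4) = (SN ((n : ℤ) + 2)).ncard := by
    unfold N SN
    have : ((2 * n + 4 : ℕ) : ℤ) = 2 * ((n : ℤ) + 2) := by push_cast; ring
    rw [this]
    rfl
  have e0 := cT n
  have e1 := cA ((n : ℤ) + 2)
  have e2 := cFA _ hM
  have e3 := cF ((n : ℤ) + 2)
  have e4 := cHF _ hM
  have e5 := cHG _ hM
  have e6 := cG1 ((n : ℤ) + 2)
  have e7 := cG2 ((n : ℤ) + 2)
  have e8 := cEG _ hM
  have e9 := cN _ hM
  have k1 : t 2 2 3 9 n = 4 * (SE ((n : ℤ) + 2)).ncard := by omega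
  have k2 : N 2 2 3 9 (2 * n + 4) = 3 * (SE ((n : ℤ) + 2)).ncard := by omega
  rw [k1, k2]
  push_cast
  ring
end

section
/- For every positive integer n, t(1,2,2,6;n) = (1/2)·N(1,1,4,6; 8n+11) and t(1,1,8,12;2n) = (1/2)·N(1,1,8,12; 16n+22). -/
theorem aux_tri (X : ℤ) : 8 * (X * (X - 1) / 2) = (2 * X - 1) ^ 2 - 1 := by
  have h := Int.even_mul_pred_self X
  obtain ⟨k, hk⟩ := h
  rw [hk]
  have : (k + k) / 2 = k := by omega
  rw [this]
  linear_combination (-4) * hk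

theorem aux_card (T S : Set (ℤ × ℤ × ℤ × ℤ))
    (f : Bool × (ℤ × ℤ × ℤ × ℤ) → ℤ × ℤ × ℤ × ℤ)
    (h1 : ∀ b P, P ∈ T → f (b, P) ∈ S)
    (h2 : ∀ b P b' P', P ∈ T → P' ∈ T → f (b, P) = f (b', P') → b = b' ∧ P = P')
    (h3 : ∀ Q ∈ S, ∃ b P, P ∈ T ∧ f (b, P) = Q) :
    (T.ncard : ℚ) = 1 / 2 * (S.ncard : ℚ) := by
  have hb : Function.Bijective (fun p : Bool × T => (⟨f (p.1, p.2.1), h1 _ _ p.2.2⟩ : S)) := by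
    constructor
    · rintro ⟨b, P, hP⟩ ⟨b', P', hP'⟩ h
      obtain ⟨h, h'⟩ := h2 b P b' P' hP hP' (by simpa using h)
      subst h; subst h'; rfl
    · rintro ⟨Q, hQ⟩
      obtain ⟨b, P, hP, h⟩ := h3 Q hQ
      exact ⟨⟨b, P, hP⟩, by simpa using h⟩
  have := Nat.card_eq_of_bijective _ hb
  rw [Nat.card_prod, Nat.card_coe_set_eq, Nat.card_coe_set_eq] at this
  rw [← this]
  simp

theorem aux_sq_odd (a : ℤ) (h : a % 2 = 1) : ∃ k, a ^ 2 = 8 * k + 1 := by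
  have := Int.sq_mod_four_eq_one_of_odd (Int.odd_iff.2 h)
  obtain ⟨m, hm⟩ : ∃ m, a = 2 * m - 1 := ⟨(a + 1) / 2, by omega⟩
  exact ⟨m * (m - 1) / 2, by rw [aux_tri, hm]; ring⟩

theorem aux_sq_even (a : ℤ) (h : a % 2 = 0) : ∃ k, a ^ 2 = 4 * k ∧ k % 2 = (a / 2) % 2 := by
  obtain ⟨m, hm⟩ : ∃ m, a = 2 * m := ⟨a / 2, by omega⟩
  refine ⟨m ^ 2, by rw [hm]; ring, ?_⟩
  have : a / 2 = m := by omega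
  rw [this, pow_two, Int.mul_emod]
  rcases Int.emod_two_eq_zero_or_one m with h | h <;> simp [h]

theorem aux_sq_par (a : ℤ) : a ^ 2 % 2 = a % 2 := by
  rw [pow_two, Int.mul_emod]
  rcases Int.emod_two_eq_zero_or_one a with h | h <;> simp [h]

/-- parity analysis for the first form -/
theorem aux_par1 (m a b c d : ℤ) (h : 8 * m + 11 = a ^ 2 + b ^ 2 + 4 * c ^ 2 + 6 * d ^ 2)
    (ha : a % 2 = 1) : d % 2 = 1 ∧ b % 2 = 0 ∧ (b / 2 + c) % 2 = 1 := by
  obtain ⟨k, hk⟩ := aux_sq_odd a ha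
  have hb := aux_sq_par b
  have hc := aux_sq_par c
  have hd := aux_sq_par d
  have hb0 : b % 2 = 0 := by omega
  obtain ⟨l, hl, hl'⟩ := aux_sq_even b hb0
  have hd1 : d % 2 = 1 := by omega
  obtain ⟨p, hp⟩ := aux_sq_odd d hd1
  refine ⟨hd1, hb0, by omega⟩

theorem aux_par1' (m a b c d : ℤ) (h : 8 * m + 11 = a ^ 2 + b ^ 2 + 4 * c ^ 2 + 6 * d ^ 2) :
    a % 2 = 1 ∨ b % 2 = 1 := by
  have ha := aux_sq_par a
  have hb := aux_sq_par b
  omega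

theorem aux_par2 (m a b c d : ℤ)
    (h : 16 * m + 22 = a ^ 2 + b ^ 2 + 8 * c ^ 2 + 12 * d ^ 2) :
    a % 2 = 1 ∧ b % 2 = 1 := by
  have ha := aux_sq_par a
  have hb := aux_sq_par b
  rcases Int.emod_two_eq_zero_or_one a with h1 | h1
  · obtain ⟨k, hk, -⟩ := aux_sq_even a h1
    obtain ⟨l, hl, -⟩ := aux_sq_even b (by omega)
    omega
  · exact ⟨h1, by omega⟩

theorem memT1 (n : ℕ) (X Y Z W : ℤ) :
    ((n : ℤ) = (1 : ℕ) * (X * (X - 1) / 2) + (2 : ℕ) * (Y * (Y - 1) / 2)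
      + (2 : ℕ) * (Z * (Z - 1) / 2) + (6 : ℕ) * (W * (W - 1) / 2)) ↔
    8 * (n : ℤ) + 11 = (2 * X - 1) ^ 2 + (2 * (Y - Z)) ^ 2 + 4 * (Y + Z - 1) ^ 2
      + 6 * (2 * W - 1) ^ 2 := by
  have hX := aux_tri X
  have hY := aux_tri Y
  have hZ := aux_tri Z
  have hW := aux_tri W
  push_cast
  constructor <;> intro h <;> linarith

theorem memT2 (n : ℕ) (X Y Z W : ℤ) :
    (((2 * n : ℕ) : ℤ) = (1 : ℕ) * (X * (X - 1) / 2) + (1 : ℕ) * (Y * (Y - 1) / 2)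
      + (8 : ℕ) * (Z * (Z - 1) / 2) + (12 : ℕ) * (W * (W - 1) / 2)) ↔
    8 * (n : ℤ) + 11 = (X + Y - 1) ^ 2 + (X - Y) ^ 2 + 4 * (2 * Z - 1) ^ 2
      + 6 * (2 * W - 1) ^ 2 := by
  have hX := aux_tri X
  have hY := aux_tri Y
  have hZ := aux_tri Z
  have hW := aux_tri W
  push_cast
  constructor <;> intro h <;> linarith

theorem part1 (n : ℕ) : (t 1 2 2 6 n : ℚ) = 1 / 2 * (N 1 1 4 6 (8 * n + 11) : ℚ) := by
  unfold t N
  apply aux_card _ _ (fun p => if p.1 then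
      (2 * p.2.1 - 1, 2 * (p.2.2.1 - p.2.2.2.1), p.2.2.1 + p.2.2.2.1 - 1, 2 * p.2.2.2.2 - 1)
    else (2 * (p.2.2.1 - p.2.2.2.1), 2 * p.2.1 - 1, p.2.2.1 + p.2.2.2.1 - 1,
      2 * p.2.2.2.2 - 1))
  · rintro b ⟨X, Y, Z, W⟩ h
    rw [Set.mem_ofPred_eq] at h
    dsimp only at h
    rw [memT1] at h
    cases b <;> simp <;> linarith
  · rintro b ⟨X, Y, Z, W⟩ b' ⟨X', Y', Z', W'⟩ - - h
    cases b <;> cases b' <;> simp at h ⊢ <;> omega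
  · rintro ⟨a, b, c, d⟩ h
    simp only [Set.mem_ofPred_eq] at h
    push_cast at h
    rcases aux_par1' n a b c d (by linarith) with ha | hb
    · obtain ⟨h1, h2, h3⟩ := aux_par1 n a b c d (by linarith) ha
      have e1 : 2 * ((a + 1) / 2) - 1 = a := by omega
      have e2 : 2 * ((c + b / 2 + 1) / 2 - (c + 1 - b / 2) / 2) = b := by omega
      have e3 : (c + b / 2 + 1) / 2 + (c + 1 - b / 2) / 2 - 1 = c := by omega
      have e4 : 2 * ((d + 1) / 2) - 1 = d := by omega
      refine ⟨true, ((a + 1) / 2, (c + b / 2 + 1) / 2, (c + 1 - b / 2) / 2, (d + 1) / 2), ?_, ?_⟩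
      · rw [Set.mem_ofPred_eq]
        dsimp only
        rw [memT1, e1, e2, e3, e4]; linarith
      · simp [e1, e2, e3, e4]
    · obtain ⟨h1, h2, h3⟩ := aux_par1 n b a c d (by linarith) hb
      have e1 : 2 * ((b + 1) / 2) - 1 = b := by omega
      have e2 : 2 * ((c + a / 2 + 1) / 2 - (c + 1 - a / 2) / 2) = a := by omega
      have e3 : (c + a / 2 + 1) / 2 + (c + 1 - a / 2) / 2 - 1 = c := by omega
      have e4 : 2 * ((d + 1) / 2) - 1 = d := by omega
      refine ⟨false, ((b + 1) / 2, (c + a / 2 + 1) / 2, (c + 1 - a / 2) / 2, (d + 1) / 2), ?_, ?_⟩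
      · rw [Set.mem_ofPred_eq]
        dsimp only
        rw [memT1, e1, e2, e3, e4]; linarith
      · simp [e1, e2, e3, e4]

/-- the swap map for the second identity -/
def g2 (X Y Z W : ℤ) : ℤ × ℤ × ℤ × ℤ :=
  if (X + Y - 1) % 2 = 1 then
    (X + Y - 1 + 2 * (2 * Z - 1), X + Y - 1 - 2 * (2 * Z - 1), (X - Y) / 2, 2 * W - 1)
  else
    (2 * (2 * Z - 1) + (X - Y), 2 * (2 * Z - 1) - (X - Y), (X + Y - 1) / 2, 2 * W - 1)

theorem part2 (n : ℕ) :
    (t 1 1 8 12 (2 * n) : ℚ) = 1 / 2 * (N 1 1 8 12 (16 * n + 22) : ℚ) := by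
  unfold t N
  apply aux_card _ _ (fun p => if p.1 then
      (2 * p.2.1 - 1, 2 * p.2.2.1 - 1, 2 * p.2.2.2.1 - 1, 2 * p.2.2.2.2 - 1)
    else g2 p.2.1 p.2.2.1 p.2.2.2.1 p.2.2.2.2)
  · rintro b ⟨X, Y, Z, W⟩ h
    rw [Set.mem_ofPred_eq] at h
    dsimp only at h
    rw [memT2] at h
    cases b
    · simp only [g2, Bool.false_eq_true, if_false]
      split_ifs with h1
      · obtain ⟨m, hm⟩ : ∃ m, X - Y = 2 * m := ⟨(X - Y) / 2, by omega⟩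
        have : (X - Y) / 2 = m := by omega
        rw [hm] at h
        simp [this]
        linarith
      · obtain ⟨m, hm⟩ : ∃ m, X + Y - 1 = 2 * m := ⟨(X + Y - 1) / 2, by omega⟩
        have : (X + Y - 1) / 2 = m := by omega
        rw [hm] at h
        simp [this]
        linarith
    · simp; linarith
  · rintro b ⟨X, Y, Z, W⟩ b' ⟨X', Y', Z', W'⟩ h h' he
    rw [Set.mem_ofPred_eq] at h h'
    dsimp only at h h'
    rw [memT2] at h h'
    have key : ∀ X Y Z W : ℤ, 8 * (n : ℤ) + 11 = (X + Y - 1) ^ 2 + (X - Y) ^ 2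
        + 4 * (2 * Z - 1) ^ 2 + 6 * (2 * W - 1) ^ 2 →
        ((X + Y - 1) % 2 = 1 → (X - Y) % 4 = 0) ∧
        (¬ (X + Y - 1) % 2 = 1 → (X + Y - 1) % 4 = 0) := by
      intro X Y Z W h
      constructor
      · intro h1
        have := aux_par1 n _ _ _ _ h h1
        omega
      · intro h1
        have := aux_par1 n (X - Y) (X + Y - 1) (2 * Z - 1) (2 * W - 1) (by linarith) (by omega)
        omega
    have k1 := key _ _ _ _ h
    have k2 := key _ _ _ _ h'
    clear h h' key
    cases b <;> cases b' <;> simp [g2] at he ⊢ <;> (try split_ifs at he) <;>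
      (try simp at he) <;> omega
  · rintro ⟨a, b, c, d⟩ h
    simp only [Set.mem_ofPred_eq] at h
    push_cast at h
    obtain ⟨ha, hb⟩ := aux_par2 n a b c d (by linarith)
    obtain ⟨u, v, rfl, rfl⟩ : ∃ u v, a = u + v ∧ b = u - v :=
      ⟨(a + b) / 2, (a - b) / 2, by omega, by omega⟩
    have h' : 8 * (n : ℤ) + 11 = u ^ 2 + v ^ 2 + 4 * c ^ 2 + 6 * d ^ 2 := by linarith
    have hd : d % 2 = 1 := by
      rcases aux_par1' n u v c d h' with h1 | h1
      · exact (aux_par1 n u v c d h' h1).1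
      · exact (aux_par1 n v u c d (by linarith) h1).1
    obtain ⟨W, rfl⟩ : ∃ W, d = 2 * W - 1 := ⟨(d + 1) / 2, by omega⟩
    rcases Int.emod_two_eq_zero_or_one c with hc | hc
    · rcases Int.emod_two_eq_zero_or_one u with hu | hu
      · obtain ⟨-, -, h3⟩ := aux_par1 n v u c (2 * W - 1) (by linarith) (by omega)
        obtain ⟨Z, rfl⟩ : ∃ Z, u = 2 * (2 * Z - 1) := ⟨(u / 2 + 1) / 2, by omega⟩
        -- new odd part is v, new even part is 2c in the first slot
        obtain ⟨X, Y, e1, e2⟩ : ∃ X Y, X + Y - 1 = 2 * c ∧ X - Y = v :=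
          ⟨(2 * c + 1 + v) / 2, (2 * c + 1 - v) / 2, by omega, by omega⟩
        refine ⟨false, (X, Y, Z, W), ?_, ?_⟩
        · rw [Set.mem_ofPred_eq]
          dsimp only
          rw [memT2, e1, e2]; linarith
        · have : ¬ (2 * c) % 2 = 1 := by omega
          simp [g2, e1, e2]
      · obtain ⟨-, -, h3⟩ := aux_par1 n u v c (2 * W - 1) (by linarith) (by omega)
        obtain ⟨Z, rfl⟩ : ∃ Z, v = 2 * (2 * Z - 1) := ⟨(v / 2 + 1) / 2, by omega⟩
        obtain ⟨X, Y, e1, e2⟩ : ∃ X Y, X + Y - 1 = u ∧ X - Y = 2 * c :=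
          ⟨(2 * c + 1 + u) / 2, (u + 1 - 2 * c) / 2, by omega, by omega⟩
        refine ⟨false, (X, Y, Z, W), ?_, ?_⟩
        · rw [Set.mem_ofPred_eq]
          dsimp only
          rw [memT2, e1, e2]; linarith
        · simp [g2, e1, e2, hu]
    · obtain ⟨Z, rfl⟩ : ∃ Z, c = 2 * Z - 1 := ⟨(c + 1) / 2, by omega⟩
      obtain ⟨X, Y, e1, e2⟩ : ∃ X Y, X + Y - 1 = u ∧ X - Y = v :=
        ⟨(u + v + 1) / 2, (u - v + 1) / 2, by omega, by omega⟩
      refine ⟨true, (X, Y, Z, W), ?_, ?_⟩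
      · rw [Set.mem_ofPred_eq]
        dsimp only
        rw [memT2, e1, e2]; linarith
      · simp; omega

theorem stmt17 (n : ℕ) (hn : 0 < n) :
    (t 1 2 2 6 n : ℚ) = 1 / 2 * (N 1 1 4 6 (8 * n + 11) : ℚ) ∧
    (t 1 1 8 12 (2 * n) : ℚ) = 1 / 2 * (N 1 1 8 12 (16 * n + 22) : ℚ) :=
  ⟨part1 n, part2 n⟩
end
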